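/- arXiv:2005.12631 — 3 statements merged into one kernel-verified Lean document; each statement's English description precedes it below -/
import Mathlib

section
/- Let F(t) = Σ_{k=0}^n f_k t^k and G(t) = Σ_{k=0}^n g_k t^k be real polynomials with nonnegative coefficients such that F(1) > 0 and G(1) > 0. Suppose there exist a real polynomial H(t), a nonzero real number λ, a sign ε ∈ {+1, −1} and a positive integer ℓ such that F(t) = λ·G(t) + ε·(1−t)^ℓ·H(t). Then for every nonnegative integer r with r < ℓ, the r-th moments agree: Σ_k k^r · f_k / F(1) = Σ_k k^r · g_k / G(1). -/
open scoped BigOperators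


namespace Polynomial

/-- The Euler operator `P ↦ X * P'` on polynomials. -/
noncomputable def eulerOp (R : Type*) [CommRing R] : R[X] →ₗ[R] R[X] :=
  LinearMap.mulLeft R X ∘ₗ derivative

section CommRing

variable {R : Type*} [CommRing R]

lemma eulerOp_apply (P : R[X]) : eulerOp R P = X * derivative P := rfl

lemma coeff_eulerOp (P : R[X]) (k : ℕ) : (eulerOp R P).coeff k = k * P.coeff k := by
  rw [eulerOp_apply]
  cases k with
  | zero => simp
  | succ k => rw [coeff_X_mul, coeff_derivative]; push_cast; ring

lemma coeff_eulerOp_pow (r : ℕ) (P : R[X]) (k : ℕ) :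
    ((eulerOp R ^ r) P).coeff k = (k : R) ^ r * P.coeff k := by
  induction r with
  | zero => simp
  | succ r ih => rw [pow_succ', Module.End.mul_apply, coeff_eulerOp, ih, pow_succ']; ring

lemma pow_sub_dvd_eulerOp_pow {p P : R[X]} {l : ℕ} (h : p ^ l ∣ P) (r : ℕ) :
    p ^ (l - r) ∣ (eulerOp R ^ r) P := by
  induction r with
  | zero => simpa using h
  | succ r ih =>
    rw [pow_succ', Module.End.mul_apply, eulerOp_apply, Nat.sub_succ']
    exact (pow_sub_one_dvd_derivative_of_pow_dvd ih).mul_left X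

lemma eval_one_eulerOp_pow_eq_zero {P : R[X]} {l r : ℕ} (h : (1 - X) ^ l ∣ P) (hr : r < l) :
    ((eulerOp R ^ r) P).eval 1 = 0 := by
  obtain ⟨Q, hQ⟩ := pow_sub_dvd_eulerOp_pow h r
  simp [hQ, (Nat.sub_pos_of_lt hr).ne']

lemma eval_one_eq_tsum_coeff [TopologicalSpace R] (P : R[X]) :
    P.eval 1 = ∑' k : ℕ, P.coeff k := by
  rw [tsum_eq_sum (s := P.support) fun k hk => notMem_support_iff.mp hk, eval_eq_sum]
  simp [Polynomial.sum]

lemma tsum_pow_mul_coeff [TopologicalSpace R] (r : ℕ) (P : R[X]) :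
    ∑' k : ℕ, (k : R) ^ r * P.coeff k = ((eulerOp R ^ r) P).eval 1 := by
  simp only [eval_one_eq_tsum_coeff, coeff_eulerOp_pow]

end CommRing

end Polynomial

/-- Lemma 1 (moment comparison).  If `F(t) = λ·G(t) + ε·(1−t)^ℓ·H(t)` where `F`, `G` have
nonnegative coefficients, degree at most `n`, and positive values at `1`, with `λ ≠ 0`,
`ε ∈ {1, −1}` and `ℓ ≥ 1`, then for every `r < ℓ` the `r`-th moments of the associated
random variables agree: `Σ_k k^r f_k / F(1) = Σ_k k^r g_k / G(1)`. -/
theorem moment_comparison (n : ℕ) (F G H : Polynomial ℝ) (lam eps : ℝ) (l : ℕ)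
    (hFdeg : F.natDegree ≤ n) (hGdeg : G.natDegree ≤ n)
    (hF : ∀ k : ℕ, 0 ≤ F.coeff k) (hG : ∀ k : ℕ, 0 ≤ G.coeff k)
    (hF1 : 0 < F.eval 1) (hG1 : 0 < G.eval 1)
    (hlam : lam ≠ 0) (heps : eps = 1 ∨ eps = -1) (hl : 1 ≤ l)
    (hEq : F = Polynomial.C lam * G + Polynomial.C eps * (1 - Polynomial.X) ^ l * H)
    (r : ℕ) (hr : r < l) :
    (∑' k : ℕ, (k : ℝ) ^ r * F.coeff k) / F.eval 1 =
      (∑' k : ℕ, (k : ℝ) ^ r * G.coeff k) / G.eval 1 := by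
  have key (s : ℕ) (hs : s < l) :
      ((Polynomial.eulerOp ℝ ^ s) F).eval 1 = lam * ((Polynomial.eulerOp ℝ ^ s) G).eval 1 := by
    have h0 := Polynomial.eval_one_eulerOp_pow_eq_zero (R := ℝ) (r := s)
      (P := Polynomial.C eps * (1 - Polynomial.X) ^ l * H)
      (Dvd.dvd.mul_right (Dvd.intro_left _ rfl) H) hs
    rw [hEq, map_add, Polynomial.eval_add, h0, add_zero, ← Polynomial.smul_eq_C_mul, map_smul,
      Polynomial.eval_smul, smul_eq_mul]
  have h1 : F.eval 1 = lam * G.eval 1 := by simpa using key 0 (by omega)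
  rw [Polynomial.tsum_pow_mul_coeff, Polynomial.tsum_pow_mul_coeff, key r hr, h1,
    mul_div_mul_left _ _ hlam]
end

section
/- The distribution of the coefficients of AE_n^+(t) is asymptotically normal as n → ∞, and likewise for AE_n^-(t). Moreover, for n ≥ 3 the mean of the coefficient distribution of AE_n^±(t) equals (n−1)/2, and for n ≥ 4 its variance equals (n+1)/12. -/
open scoped BigOperators


/-- Number of excedances of a permutation of `{1,...,n}` (0-indexed model). -/
def excA {n : ℕ} (π : Equiv.Perm (Fin n)) : ℕ :=
  (Finset.univ.filter (fun i : Fin n => i < π i)).card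

/-- Number of inversions of a permutation. -/
def invA {n : ℕ} (π : Equiv.Perm (Fin n)) : ℕ :=
  (Finset.univ.filter (fun p : Fin n × Fin n => p.1 < p.2 ∧ π p.2 < π p.1)).card

/-- The cumulative distribution function of the standard normal distribution. -/
noncomputable def stdNormalCDF (x : ℝ) : ℝ :=
  ∫ t in Set.Iic x, Real.exp (-t ^ 2 / 2) / Real.sqrt (2 * Real.pi)

/-- Row sum `Sum_n = Σ_k s_{n,k}` of a triangular array of counts. -/
noncomputable def rowSum (c : ℕ → ℕ → ℕ) (n : ℕ) : ℝ := ∑' k : ℕ, (c n k : ℝ)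

/-- Mean `Σ_k k·s_{n,k}/Sum_n` of row `n`. -/
noncomputable def rowMean (c : ℕ → ℕ → ℕ) (n : ℕ) : ℝ :=
  (∑' k : ℕ, (k : ℝ) * (c n k : ℝ)) / rowSum c n

/-- Variance `Σ_k k²·s_{n,k}/Sum_n − (mean)²` of row `n`. -/
noncomputable def rowVar (c : ℕ → ℕ → ℕ) (n : ℕ) : ℝ :=
  (∑' k : ℕ, (k : ℝ) ^ 2 * (c n k : ℝ)) / rowSum c n - rowMean c n ^ 2

/-- `Σ_{k ≤ ⌊y⌋} s_{n,k} / Sum_n` (for `k : ℕ`, `k ≤ ⌊y⌋ ↔ (k:ℝ) ≤ y`). -/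
noncomputable def rowCDF (c : ℕ → ℕ → ℕ) (n : ℕ) (y : ℝ) : ℝ :=
  (∑' k : ℕ, if (k : ℝ) ≤ y then (c n k : ℝ) else 0) / rowSum c n

/-- The triangular array `c` is asymptotically normal:
`lim_n sup_x |Σ_{k ≤ ⌊xσ_n + μ_n⌋} s_{n,k}/Sum_n − Φ(x)| = 0`, where `μ_n`, `σ_n²` are
the mean and variance of row `n`. -/
def IsAsympNormal (c : ℕ → ℕ → ℕ) : Prop :=
  Filter.Tendsto
    (fun n => ⨆ x : ℝ,
      |rowCDF c n (x * Real.sqrt (rowVar c n) + rowMean c n) - stdNormalCDF x|)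
    Filter.atTop (nhds 0)

/-- `AE⁺_{n,k}`: number of even permutations of `{1,...,n}` with `k` excedances. -/
def cAEp (n k : ℕ) : ℕ :=
  (Finset.univ.filter (fun π : Equiv.Perm (Fin n) => Even (invA π) ∧ excA π = k)).card

/-- `AE⁻_{n,k}`: number of odd permutations of `{1,...,n}` with `k` excedances. -/
def cAEm (n k : ℕ) : ℕ :=
  (Finset.univ.filter (fun π : Equiv.Perm (Fin n) => ¬ Even (invA π) ∧ excA π = k)).card


section Combinatorics

open Equiv Finset

/-- Removing the entry `j.succ` placed at position `0` turns excedances of the enlarged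
permutation into excedances of `e`. -/
lemma excA_decomposeFin_symm_succ {n : ℕ} (j : Fin n) (e : Perm (Fin n)) :
    excA (Perm.decomposeFin.symm (j.succ, e)) =
      if e.symm j < j then excA e else excA e + 1 := by
  have key : ∀ x : Fin n, (if x.succ < swap 0 j.succ (e x).succ then 1 else 0) =
      if x = e.symm j then 0 else if x < e x then 1 else 0 := by
    intro x
    by_cases h : x = e.symm j
    · subst h
      simp
    · have h' : e x ≠ j := fun h' => h (by simp [← h'])
      rw [swap_apply_of_ne_of_ne (Fin.succ_ne_zero _) (by simpa using h')]
      simp [h]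
  have hsplit : ∀ x : Fin n, (if x < e x then 1 else 0) =
      (if x = e.symm j then 0 else if x < e x then 1 else 0) +
        if x = e.symm j then (if e.symm j < j then 1 else 0) else 0 := by
    intro x
    by_cases h : x = e.symm j
    · subst h; simp
    · simp [h]
  have h1 : excA (Perm.decomposeFin.symm (j.succ, e)) =
      1 + ∑ x : Fin n, if x = e.symm j then 0 else if x < e x then 1 else 0 := by
    simp only [excA, card_filter, Fin.sum_univ_succ, Perm.decomposeFin_symm_apply_zero,
      Perm.decomposeFin_symm_apply_succ, key]
    simp
  have h2 : excA e = (∑ x : Fin n, if x = e.symm j then 0 else if x < e x then 1 else 0) +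
      if e.symm j < j then 1 else 0 := by
    simp only [excA, card_filter]
    rw [sum_congr rfl fun x _ => hsplit x, sum_add_distrib]
    simp
  rw [h1, h2]
  split_ifs <;> omega

lemma excA_decomposeFin_symm_zero {n : ℕ} (e : Perm (Fin n)) :
    excA (Perm.decomposeFin.symm (0, e)) = excA e := by
  simp only [excA, card_filter, Fin.sum_univ_succ, Perm.decomposeFin_symm_apply_zero,
    Perm.decomposeFin_symm_apply_succ]
  simp

lemma excA_fin_one (e : Perm (Fin 1)) : excA e = 0 := by
  simp [Subsingleton.elim e 1, excA]

lemma excA_eq_card_symm {n : ℕ} (e : Perm (Fin n)) :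
    (univ.filter fun j : Fin n => e.symm j < j).card = excA e := by
  refine card_bij' (fun j _ => e.symm j) (fun i _ => e i) ?_ ?_ ?_ ?_ <;> simp

lemma sum_excA_decomposeFin_symm_succ {n : ℕ} (e : Perm (Fin n)) (f : ℕ → ℝ) :
    ∑ j : Fin n, f (excA (Perm.decomposeFin.symm (j.succ, e))) =
      excA e * f (excA e) + (n - excA e) * f (excA e + 1) := by
  have hcompl : ((univ.filter fun j : Fin n => ¬ e.symm j < j).card : ℝ) = n - excA e := by
    have := card_filter_add_card_filter_not (s := (univ : Finset (Fin n)))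
      (fun j : Fin n => e.symm j < j)
    rw [excA_eq_card_symm, card_univ, Fintype.card_fin] at this
    rw [eq_sub_iff_add_eq']
    exact_mod_cast this
  simp only [excA_decomposeFin_symm_succ, apply_ite f]
  rw [sum_ite, sum_const, sum_const, nsmul_eq_mul, nsmul_eq_mul, hcompl, excA_eq_card_symm]

/-- The sum of `f (exc π)` over all permutations. -/
noncomputable def excSum (n : ℕ) (f : ℕ → ℝ) : ℝ := ∑ π : Perm (Fin n), f (excA π)

/-- The sum of `sign π * f (exc π)` over all permutations. -/
noncomputable def signedExcSum (n : ℕ) (f : ℕ → ℝ) : ℝ :=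
  ∑ π : Perm (Fin n), ((Perm.sign π : ℤ) : ℝ) * f (excA π)

lemma excSum_succ (n : ℕ) (f : ℕ → ℝ) :
    excSum (n + 1) f = excSum n fun e => (e + 1) * f e + (n - e) * f (e + 1) := by
  unfold excSum
  rw [univ_perm_fin_succ, sum_map, Fintype.sum_prod_type_right]
  refine sum_congr rfl fun e _ => ?_
  rw [Fin.sum_univ_succ]
  simp only [Equiv.coe_toEmbedding, excA_decomposeFin_symm_zero,
    sum_excA_decomposeFin_symm_succ]
  ring

lemma signedExcSum_succ (n : ℕ) (f : ℕ → ℝ) :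
    signedExcSum (n + 1) f =
      signedExcSum n fun e => (1 - e) * f e - (n - e) * f (e + 1) := by
  unfold signedExcSum
  rw [univ_perm_fin_succ, sum_map, Fintype.sum_prod_type_right]
  refine sum_congr rfl fun e _ => ?_
  rw [Fin.sum_univ_succ]
  simp only [Equiv.coe_toEmbedding, excA_decomposeFin_symm_zero,
    Perm.decomposeFin.symm_sign, Fin.succ_ne_zero, if_true, if_false]
  rw [← mul_sum, sum_excA_decomposeFin_symm_succ]
  push_cast
  ring

lemma excSum_add (n : ℕ) (f g : ℕ → ℝ) :
    excSum n (fun e => f e + g e) = excSum n f + excSum n g := sum_add_distrib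

lemma excSum_mul (n : ℕ) (a : ℝ) (f : ℕ → ℝ) :
    excSum n (fun e => a * f e) = a * excSum n f := (mul_sum _ _ _).symm

lemma signedExcSum_add (n : ℕ) (f g : ℕ → ℝ) :
    signedExcSum n (fun e => f e + g e) = signedExcSum n f + signedExcSum n g := by
  simp only [signedExcSum, mul_add, sum_add_distrib]

lemma signedExcSum_mul (n : ℕ) (a : ℝ) (f : ℕ → ℝ) :
    signedExcSum n (fun e => a * f e) = a * signedExcSum n f := by
  simp only [signedExcSum, mul_sum, mul_left_comm]

lemma excSum_one (n : ℕ) : excSum n (fun _ => 1) = n.factorial := by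
  simp [excSum, Fintype.card_perm]

lemma excSum_id {n : ℕ} (hn : 1 ≤ n) :
    excSum n (fun e => e) = n.factorial * ((n - 1) / 2) := by
  induction n, hn using Nat.le_induction with
  | base => simp [excSum, excA_fin_one]
  | succ n _ ih =>
    have : (fun e : ℕ => ((e : ℝ) + 1) * e + (n - e) * ((e + 1 : ℕ) : ℝ)) =
        fun e : ℕ => (n : ℝ) * e + n * 1 := by
      funext e; push_cast; ring
    rw [excSum_succ, this, excSum_add, excSum_mul, excSum_mul, ih, excSum_one,
      Nat.factorial_succ]
    push_cast
    ring

lemma excSum_sq {n : ℕ} (hn : 2 ≤ n) :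
    excSum n (fun e => (e : ℝ) ^ 2) =
      n.factorial * (((n : ℝ) + 1) / 12 + ((n - 1) / 2) ^ 2) := by
  have step : ∀ n : ℕ, 1 ≤ n → excSum (n + 1) (fun e => (e : ℝ) ^ 2) =
      (n - 1) * excSum n (fun e => (e : ℝ) ^ 2) +
        ((2 * n - 1) * (n.factorial * ((n - 1) / 2)) + n * n.factorial) := by
    intro n hn
    have : (fun e : ℕ => ((e : ℝ) + 1) * (e : ℝ) ^ 2 + (n - e) * ((e + 1 : ℕ) : ℝ) ^ 2) =
        fun e : ℕ => ((n : ℝ) - 1) * (e : ℝ) ^ 2 + ((2 * n - 1) * e + n * 1) := by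
      funext e; push_cast; ring
    rw [excSum_succ, this, excSum_add, excSum_add, excSum_mul, excSum_mul, excSum_mul,
      excSum_id hn, excSum_one]
  induction n, hn using Nat.le_induction with
  | base =>
    rw [step 1 le_rfl]
    norm_num
  | succ n hn ih =>
    rw [step n (by omega), ih, Nat.factorial_succ]
    push_cast
    ring

lemma signedExcSum_one {n : ℕ} (hn : 2 ≤ n) : signedExcSum n (fun _ => 1) = 0 := by
  have step : ∀ n : ℕ, signedExcSum (n + 1) (fun _ => 1) =
      (1 - n) * signedExcSum n (fun _ => 1) := by
    intro n
    rw [signedExcSum_succ, ← signedExcSum_mul]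
    congr 1
    funext e
    ring
  induction n, hn using Nat.le_induction with
  | base => simp [step]
  | succ n hn ih => rw [step, ih, mul_zero]

lemma signedExcSum_id {n : ℕ} (hn : 3 ≤ n) : signedExcSum n (fun e => e) = 0 := by
  have step : ∀ n : ℕ, 2 ≤ n → signedExcSum (n + 1) (fun e => e) =
      (2 - n) * signedExcSum n (fun e => e) := by
    intro n hn
    have : (fun e : ℕ => (1 - (e : ℝ)) * e - (n - e) * ((e + 1 : ℕ) : ℝ)) =
        fun e : ℕ => (2 - (n : ℝ)) * e + (-n) * 1 := by
      funext e; push_cast; ring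
    rw [signedExcSum_succ, this, signedExcSum_add, signedExcSum_mul, signedExcSum_mul,
      signedExcSum_one hn]
    ring
  induction n, hn using Nat.le_induction with
  | base => simp [step 2 le_rfl]
  | succ n hn ih => rw [step n (by omega), ih, mul_zero]

lemma signedExcSum_sq {n : ℕ} (hn : 4 ≤ n) :
    signedExcSum n (fun e => (e : ℝ) ^ 2) = 0 := by
  have step : ∀ n : ℕ, 3 ≤ n → signedExcSum (n + 1) (fun e => (e : ℝ) ^ 2) =
      (3 - n) * signedExcSum n (fun e => (e : ℝ) ^ 2) := by
    intro n hn
    have : (fun e : ℕ => (1 - (e : ℝ)) * (e : ℝ) ^ 2 - (n - e) * ((e + 1 : ℕ) : ℝ) ^ 2) =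
        fun e : ℕ => (3 - (n : ℝ)) * (e : ℝ) ^ 2 + ((1 - 2 * n) * e + (-n) * 1) := by
      funext e; push_cast; ring
    rw [signedExcSum_succ, this, signedExcSum_add, signedExcSum_add, signedExcSum_mul,
      signedExcSum_mul, signedExcSum_mul, signedExcSum_one (by omega), signedExcSum_id hn]
    ring
  induction n, hn using Nat.le_induction with
  | base => simp [step 3 le_rfl]
  | succ n hn ih => rw [step n (by omega), ih, mul_zero]

/-- Pascal's rule for alternating binomial sums. -/
lemma sum_neg_one_pow_choose_succ_mul (n : ℕ) (F : ℕ → ℝ) :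
    ∑ j ∈ range (n + 2), (-1) ^ j * ((n + 1).choose j : ℝ) * F j =
      ∑ j ∈ range (n + 1), (-1) ^ j * (n.choose j : ℝ) * (F j - F (j + 1)) := by
  have h : ∑ j ∈ range (n + 1), (-1) ^ j * (n.choose j : ℝ) * F j =
      ∑ j ∈ range (n + 1), (-1) ^ (j + 1) * (n.choose (j + 1) : ℝ) * F (j + 1) + F 0 := by
    rw [sum_range_succ', sum_range_succ _ n]
    simp
  simp only [mul_sub, sum_sub_distrib]
  rw [h, sum_range_succ']
  simp only [Nat.choose_succ_succ', Nat.choose_zero_right, pow_zero, Nat.cast_one, one_mul]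
  rw [add_sub_right_comm, ← sum_sub_distrib]
  congr 1
  refine sum_congr rfl fun j _ => ?_
  push_cast
  ring

lemma sum_neg_one_pow_choose_telescope (n : ℕ) (F : ℕ → ℝ) :
    ∑ j ∈ range (n + 1), (-1) ^ j * (n.choose j : ℝ) * (j * F j + (n - j) * F (j + 1)) = 0 := by
  have h : ∀ j ∈ range (n + 1),
      (-1) ^ j * (n.choose j : ℝ) * (j * F j + (n - j) * F (j + 1)) =
      (-1) ^ j * (n.choose j : ℝ) * j * F j -
        (-1) ^ (j + 1) * (n.choose (j + 1) : ℝ) * (j + 1 : ℕ) * F (j + 1) := by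
    intro j hj
    have hj' : j ≤ n := by simpa [Nat.lt_succ_iff] using hj
    have := congrArg (Nat.cast : ℕ → ℝ) (Nat.choose_succ_right_eq n j)
    push_cast [hj'] at this ⊢
    linear_combination (-1) ^ j * F (j + 1) * (-this)
  rw [sum_congr rfl h, sum_range_sub' fun j => (-1) ^ j * (n.choose j : ℝ) * j * F j]
  simp

lemma signedExcSum_eq_sum (n : ℕ) (f : ℕ → ℝ) :
    signedExcSum (n + 1) f = ∑ k ∈ range (n + 1), (-1) ^ k * (n.choose k : ℝ) * f k := by
  induction n generalizing f with
  | zero => simp [signedExcSum, excA_fin_one]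
  | succ n ih =>
    rw [signedExcSum_succ, ih, sum_neg_one_pow_choose_succ_mul, ← sub_eq_zero,
      ← sum_sub_distrib, ← neg_eq_zero, ← sum_neg_distrib]
    refine Eq.trans ?_ (sum_neg_one_pow_choose_telescope n f)
    refine sum_congr rfl fun k _ => ?_
    push_cast
    ring

lemma abs_signedExcSum_le (n : ℕ) {f : ℕ → ℝ} (hf : ∀ k, |f k| ≤ 1) :
    |signedExcSum (n + 1) f| ≤ 2 ^ n := by
  rw [signedExcSum_eq_sum]
  calc _ ≤ ∑ k ∈ range (n + 1), |(-1) ^ k * (n.choose k : ℝ) * f k| := abs_sum_le_sum_abs _ _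
    _ ≤ ∑ k ∈ range (n + 1), (n.choose k : ℝ) := by
      refine sum_le_sum fun k _ => ?_
      rw [abs_mul, abs_mul, abs_pow, abs_neg, abs_one, one_pow, one_mul, Nat.abs_cast]
      exact mul_le_of_le_one_right (Nat.cast_nonneg _) (hf k)
    _ = 2 ^ n := by exact_mod_cast Nat.sum_range_choose n

/-- The truncated-power formula for `n!` times the distribution function of the sum of
`n` independent uniform variables on `[0, 1]`. -/
noncomputable def irwinHall (n : ℕ) (x : ℝ) : ℝ :=
  ∑ j ∈ range (n + 1), (-1) ^ j * (n.choose j : ℝ) * max (x - j) 0 ^ n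

lemma irwinHall_of_nonpos {n : ℕ} (hn : 1 ≤ n) {x : ℝ} (hx : x ≤ 0) : irwinHall n x = 0 := by
  refine sum_eq_zero fun j _ => ?_
  rw [max_eq_right (by linarith [(Nat.cast_nonneg j : (0 : ℝ) ≤ j)]), zero_pow (by omega),
    mul_zero]

lemma irwinHall_succ {n : ℕ} (hn : 1 ≤ n) (x : ℝ) :
    irwinHall (n + 1) x = x * irwinHall n x + (n + 1 - x) * irwinHall n (x - 1) := by
  have hpow : ∀ y : ℝ, max y 0 ^ (n + 1) = y * max y 0 ^ n := by
    intro y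
    rcases le_total y 0 with h | h
    · rw [max_eq_right h, zero_pow (by omega), zero_pow (by omega), mul_zero]
    · rw [max_eq_left h, pow_succ']
  have htel := sum_neg_one_pow_choose_telescope n fun j => max (x - j) 0 ^ n
  unfold irwinHall
  rw [sum_neg_one_pow_choose_succ_mul n fun j => max (x - j) 0 ^ (n + 1), ← sub_eq_zero,
    mul_sum, mul_sum, ← sum_add_distrib, ← sum_sub_distrib, ← neg_eq_zero, ← sum_neg_distrib]
  refine Eq.trans ?_ htel
  refine sum_congr rfl fun j _ => ?_
  rw [hpow, hpow, show x - 1 - (j : ℝ) = x - (j + 1 : ℕ) by push_cast; ring]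
  push_cast
  ring

/-- The cumulative Eulerian numbers are values of the Irwin–Hall distribution function. -/
lemma excSum_lt_eq_irwinHall {n : ℕ} (hn : 1 ≤ n) (m : ℕ) :
    excSum n (fun e => if e < m then 1 else 0) = irwinHall n m := by
  induction n, hn using Nat.le_induction generalizing m with
  | base =>
    rcases m with _ | m
    · rw [irwinHall_of_nonpos le_rfl (by simp)]
      simp [excSum]
    · simp [excSum, excA_fin_one, irwinHall, sum_range_succ,
        max_eq_left (by positivity : (0 : ℝ) ≤ m + 1)]
  | succ n hn ih =>
    rcases m with _ | m
    · rw [irwinHall_of_nonpos (by omega) (by simp)]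
      simp [excSum]
    · have : (fun e : ℕ => ((e : ℝ) + 1) * (if e < m + 1 then 1 else 0) +
          (n - e) * (if e + 1 < m + 1 then 1 else 0)) =
          fun e : ℕ => ((m : ℝ) + 1) * (if e < m + 1 then 1 else 0) +
            (n - m) * (if e < m then 1 else 0) := by
        funext e
        rcases lt_trichotomy e m with h | h | h
        · simp only [h, Nat.lt_succ_of_lt h, Nat.succ_lt_succ h, if_true]
          ring
        · simp [h]
        · simp [show ¬ e < m + 1 by omega, show ¬ e < m by omega]
      rw [excSum_succ, this, excSum_add, excSum_mul, excSum_mul, ih, ih, irwinHall_succ hn]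
      push_cast
      rw [add_sub_cancel_right]
      ring

lemma sign_eq_neg_one_pow_invA {n : ℕ} (π : Perm (Fin n)) :
    Perm.sign π = (-1) ^ invA π := by
  rw [Perm.sign_eq_prod_prod_Iio, invA, ← prod_const, prod_filter,
    Fintype.prod_prod_type_right]
  refine prod_congr rfl fun j _ => ?_
  rw [← filter_gt_eq_Iio, prod_filter]
  refine prod_congr rfl fun i _ => ?_
  by_cases h : i < j
  · rcases lt_or_gt_of_ne (π.injective.ne h.ne) with h' | h' <;> simp [h, h', h'.not_gt]
  · simp [h]

lemma sum_mul_card_filter {n : ℕ} (p : Perm (Fin n) → Prop) [DecidablePred p] (g : ℕ → ℝ) :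
    ∑' k, g k * ((univ.filter fun π : Perm (Fin n) => p π ∧ excA π = k).card : ℝ) =
      ∑ π : Perm (Fin n), if p π then g (excA π) else 0 := by
  have h : HasSum (fun k : ℕ => ∑ π : Perm (Fin n), if k = excA π then
      (if p π then g (excA π) else 0) else 0)
      (∑ π : Perm (Fin n), if p π then g (excA π) else 0) :=
    hasSum_sum fun π _ => hasSum_ite_eq (excA π) _
  rw [← h.tsum_eq]
  refine tsum_congr fun k => ?_
  rw [card_filter, Nat.cast_sum, mul_sum]
  refine sum_congr rfl fun π _ => ?_
  by_cases h2 : k = excA π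
  · simp [h2]
  · simp [h2, Ne.symm h2]

lemma tsum_mul_cAEp (n : ℕ) (g : ℕ → ℝ) :
    ∑' k, g k * (cAEp n k : ℝ) = (excSum n g + 1 * signedExcSum n g) / 2 := by
  simp only [cAEp]
  rw [sum_mul_card_filter, one_mul, excSum, signedExcSum, ← sum_add_distrib, sum_div]
  refine sum_congr rfl fun π _ => ?_
  rw [sign_eq_neg_one_pow_invA]
  split_ifs with h
  · simp [h.neg_one_pow]
  · simp [(Nat.not_even_iff_odd.1 h).neg_one_pow]

lemma tsum_mul_cAEm (n : ℕ) (g : ℕ → ℝ) :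
    ∑' k, g k * (cAEm n k : ℝ) = (excSum n g + (-1) * signedExcSum n g) / 2 := by
  simp only [cAEm]
  rw [sum_mul_card_filter, excSum, signedExcSum, mul_sum, ← sum_add_distrib, sum_div]
  refine sum_congr rfl fun π _ => ?_
  rw [sign_eq_neg_one_pow_invA]
  split_ifs with h
  · simp [h.neg_one_pow]
  · simp [(Nat.not_even_iff_odd.1 h).neg_one_pow]

end Combinatorics

section Distribution

open MeasureTheory ProbabilityTheory Filter Topology

lemma integral_max_sub_pow {n : ℕ} (hn : n ≠ 0) (y : ℝ) :
    ∫ u in (0 : ℝ)..1, max (y - u) 0 ^ n =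
      (max y 0 ^ (n + 1) - max (y - 1) 0 ^ (n + 1)) / (n + 1) := by
  have hderiv : ∀ u ∈ Set.Ioo (0 : ℝ) 1 \ {y}, HasDerivAt
      (fun u : ℝ => -(max (y - u) 0 ^ (n + 1)) / (n + 1)) (max (y - u) 0 ^ n) u := by
    rintro u ⟨-, hu⟩
    rcases lt_or_gt_of_ne (show u ≠ y from hu) with h | h
    · have h1 : HasDerivAt (fun u : ℝ => -((y - u) ^ (n + 1)) / (n + 1)) ((y - u) ^ n) u := by
        have := ((((hasDerivAt_id u).const_sub y).pow (n + 1)).neg).div_const ((n : ℝ) + 1)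
        refine this.congr_deriv ?_
        simp
        field_simp
      rw [max_eq_left (by linarith)]
      refine h1.congr_of_eventuallyEq ?_
      filter_upwards [eventually_lt_nhds h] with v hv
      rw [max_eq_left (by linarith)]
    · rw [max_eq_right (by linarith), zero_pow hn]
      refine (hasDerivAt_const u (0 : ℝ)).congr_of_eventuallyEq ?_
      filter_upwards [eventually_gt_nhds h] with v hv
      rw [max_eq_right (by linarith), zero_pow (by omega)]
      simp
  rw [integral_eq_of_hasDerivAt_off_countable_of_le _ _ zero_le_one (Set.countable_singleton y)
    (by fun_prop) hderiv (by apply Continuous.intervalIntegrable; fun_prop)]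
  simp
  ring

lemma integral_irwinHall (n : ℕ) (hn : 1 ≤ n) (x : ℝ) :
    ∫ u in (0 : ℝ)..1, irwinHall n (x - u) = irwinHall (n + 1) x / (n + 1) := by
  unfold irwinHall
  rw [sum_neg_one_pow_choose_succ_mul n fun j => max (x - j) 0 ^ (n + 1),
    intervalIntegral.integral_finsetSum
      (fun j _ => by apply Continuous.intervalIntegrable; fun_prop), Finset.sum_div]
  refine Finset.sum_congr rfl fun j _ => ?_
  simp only [intervalIntegral.integral_const_mul, sub_right_comm x _ (j : ℝ)]
  rw [integral_max_sub_pow (by omega)]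
  push_cast
  rw [mul_div_assoc, sub_sub]

/-- The uniform distribution on the unit interval. -/
noncomputable def unitUniform : Measure ℝ := volume.restrict (Set.Icc 0 1)

instance : IsProbabilityMeasure unitUniform := ⟨by simp [unitUniform]⟩

lemma integral_unitUniform (f : ℝ → ℝ) :
    ∫ x, f x ∂unitUniform = ∫ x in (0 : ℝ)..1, f x := by
  rw [unitUniform, integral_Icc_eq_integral_Ioc, intervalIntegral.integral_of_le zero_le_one]

lemma memLp_id_unitUniform : MemLp (fun x => x) 2 unitUniform :=
  MemLp.of_bound (by fun_prop) 1 <| by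
    rw [unitUniform]
    filter_upwards [ae_restrict_mem measurableSet_Icc] with x hx
    rw [Real.norm_eq_abs, abs_le]
    constructor <;> linarith [hx.1, hx.2]

lemma variance_id_unitUniform : Var[fun x => x; unitUniform] = 1 / 12 := by
  rw [variance_eq_sub memLp_id_unitUniform]
  simp only [Pi.pow_apply, integral_unitUniform, integral_id, integral_pow]
  norm_num

lemma unitUniform_real_Iic (x : ℝ) : unitUniform.real (Set.Iic x) = irwinHall 1 x := by
  have : Set.Iic x ∩ Set.Icc 0 1 = Set.Icc 0 (min x 1) := by
    ext u; simp; tauto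
  rw [unitUniform, measureReal_restrict_apply measurableSet_Iic, this, Real.volume_real_Icc]
  simp [irwinHall, Finset.sum_range_succ]
  rcases le_total x 1 with h | h
  · simp [h]
  · rw [min_eq_right h, max_eq_left (by linarith), max_eq_left (by linarith),
      max_eq_left (by linarith)]
    ring

/-- The distribution function of a sum of `n` independent uniform variables on `[0, 1]`. -/
lemma measureReal_sum_le_eq_irwinHall {Ω : Type*} {mΩ : MeasurableSpace Ω} {P : Measure Ω}
    [IsProbabilityMeasure P] {X : ℕ → Ω → ℝ} (hX : ∀ i, Measurable (X i))
    (hlaw : ∀ i, HasLaw (X i) unitUniform P) (hindep : iIndepFun X P) {n : ℕ} (hn : 1 ≤ n)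
    (x : ℝ) :
    P.real {ω | ∑ k ∈ Finset.range n, X k ω ≤ x} = irwinHall n x / n.factorial := by
  induction n, hn using Nat.le_induction generalizing x with
  | base =>
    rw [← unitUniform_real_Iic, ← (hlaw 0).map_eq, map_measureReal_apply (hX 0) measurableSet_Iic]
    simp
    rfl
  | succ n hn ih =>
    have hS : Measurable (∑ k ∈ Finset.range n, X k) := by
      rw [show ∑ k ∈ Finset.range n, X k = fun ω => ∑ k ∈ Finset.range n, X k ω by
        ext; simp]
      exact Finset.measurable_sum _ fun i _ => hX i
    have hind : IndepFun (∑ k ∈ Finset.range n, X k) (X n) P :=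
      hindep.indepFun_sum_range_succ hX n
    have hprod := (indepFun_iff_map_prod_eq_prod_map_map hS.aemeasurable (hX n).aemeasurable).1 hind
    rw [(hlaw n).map_eq] at hprod
    set S := ∑ k ∈ Finset.range n, X k
    have hmeas : MeasurableSet {p : ℝ × ℝ | p.1 + p.2 ≤ x} :=
      measurableSet_le (by fun_prop) (by fun_prop)
    have h1 : P.real {ω | ∑ k ∈ Finset.range (n + 1), X k ω ≤ x} =
        ((P.map S).prod unitUniform).real {p : ℝ × ℝ | p.1 + p.2 ≤ x} := by
      rw [← hprod, map_measureReal_apply (hS.prodMk (hX n)) hmeas]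
      congr 1
      ext ω
      simp [Finset.sum_range_succ, S]
    have hprob : IsProbabilityMeasure (P.map S) := Measure.isProbabilityMeasure_map hS.aemeasurable
    have h2 : ∀ u : ℝ, (P.map S).real ((fun p : ℝ => (p, u)) ⁻¹' {p : ℝ × ℝ | p.1 + p.2 ≤ x}) =
        irwinHall n (x - u) / n.factorial := by
      intro u
      rw [map_measureReal_apply hS (measurable_prodMk_right hmeas), ← ih]
      congr 1
      ext ω
      simp [S, le_sub_iff_add_le]
    rw [h1, measureReal_def, Measure.prod_apply_symm hmeas, ← integral_toReal]
    · simp only [← measureReal_def, h2]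
      rw [integral_unitUniform, intervalIntegral.integral_div, integral_irwinHall n hn,
        Nat.factorial_succ]
      push_cast
      field_simp
    · exact (measurable_measure_prodMk_right hmeas).aemeasurable
    · exact .of_forall fun u => measure_lt_top _ _

lemma stdNormalCDF_eq_measureReal (x : ℝ) :
    stdNormalCDF x = (gaussianReal 0 1).real (Set.Iic x) := by
  rw [measureReal_def, gaussianReal_apply_eq_integral _ one_ne_zero, ENNReal.toReal_ofReal
    (setIntegral_nonneg measurableSet_Iic fun _ _ => gaussianPDFReal_nonneg _ _ _)]
  simp only [stdNormalCDF, gaussianPDFReal]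
  congr 1
  funext t
  simp [div_eq_inv_mul]

lemma stdNormalCDF_eq_cdf (x : ℝ) : stdNormalCDF x = cdf (gaussianReal 0 1) x := by
  rw [stdNormalCDF_eq_measureReal, cdf_eq_real]

lemma continuous_stdNormalCDF : Continuous stdNormalCDF := by
  have hint : Integrable fun t : ℝ => Real.exp (-t ^ 2 / 2) / Real.sqrt (2 * Real.pi) := by
    have := (integrable_exp_neg_mul_sq (b := 1 / 2) (by norm_num)).div_const √(2 * Real.pi)
    refine this.congr (.of_forall fun t => ?_)
    dsimp only
    congr 2
    ring
  have h : stdNormalCDF = fun x => stdNormalCDF 0 +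
      ∫ t in (0 : ℝ)..x, Real.exp (-t ^ 2 / 2) / Real.sqrt (2 * Real.pi) := by
    funext x
    rw [← intervalIntegral.integral_Iic_sub_Iic hint.integrableOn hint.integrableOn]
    simp [stdNormalCDF]
  rw [h]
  exact continuous_const.add (intervalIntegral.continuous_primitive
    (fun _ _ => hint.intervalIntegrable) 0)

/-- The central limit theorem for the Irwin–Hall distribution. -/
lemma tendsto_irwinHall (z : ℝ) :
    Tendsto (fun n : ℕ => irwinHall n (n / 2 + √n * (z / √12)) / n.factorial) atTop
      (𝓝 (stdNormalCDF z)) := by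
  obtain ⟨Ω, mΩ, P, X, hX, hlaw, hindep, hP⟩ := exists_iid ℕ unitUniform
  have hvar : Var[X 0; P] = 1 / 12 := by
    rw [(hlaw 0).variance_eq]; exact variance_id_unitUniform
  have hmean : P[X 0] = 1 / 2 := by
    rw [(hlaw 0).integral_eq, integral_unitUniform]; simp
  have hc : (0 : ℝ) < √12 := by positivity
  have hY : HasLaw (fun z : ℝ => (√12)⁻¹ * z) (gaussianReal 0 Var[X 0; P].toNNReal)
      (gaussianReal 0 1) := by
    rw [hvar]
    convert gaussianReal_const_mul (HasLaw.id (μ := gaussianReal 0 1)) (√12)⁻¹ using 2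
    · simp
    · simp
    · apply NNReal.eq
      simp
  have hident : ∀ i, IdentDistrib (X i) (X 0) P P := fun i => (hlaw i).identDistrib (hlaw 0)
  have hmem : MemLp (X 0) 2 P := by
    have := memLp_id_unitUniform
    rw [← (hlaw 0).map_eq] at this
    exact this.comp_of_map (hX 0).aemeasurable
  have hclt := tendstoInDistribution_inv_sqrt_mul_sum_sub hY hmem hindep hident
  have hnull : ((gaussianReal 0 1).map (fun z : ℝ => (√12)⁻¹ * z))
      (frontier (Set.Iic (z / √12))) = 0 := by
    rw [hY.map_eq, frontier_Iic, hvar]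
    have := nullSingletonClass_gaussianReal (μ := 0) (v := (1 / 12 : ℝ).toNNReal) (by simp)
    exact measure_singleton _
  have hlim := (ENNReal.tendsto_toReal
    (measure_ne_top ((gaussianReal 0 1).map fun z : ℝ => (√12)⁻¹ * z) _)).comp
    (ProbabilityMeasure.tendsto_measure_of_null_frontier_of_tendsto' hclt.tendsto hnull)
  have hval : ((gaussianReal 0 1).map (fun z : ℝ => (√12)⁻¹ * z)).real (Set.Iic (z / √12)) =
      stdNormalCDF z := by
    rw [map_measureReal_apply (by fun_prop) measurableSet_Iic, stdNormalCDF_eq_measureReal]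
    congr 1
    ext w
    simp only [Set.mem_preimage, Set.mem_Iic, div_eq_inv_mul]
    exact mul_le_mul_iff_right₀ (inv_pos.2 hc)
  rw [← hval]
  refine hlim.congr' ?_
  filter_upwards [eventually_ge_atTop 1] with n hn
  have hsn : (0 : ℝ) < √n := by positivity
  rw [← measureReal_sum_le_eq_irwinHall hX hlaw hindep hn]
  simp only [Function.comp_apply, ProbabilityMeasure.coe_mk, ← measureReal_def]
  rw [map_measureReal_apply (by fun_prop) measurableSet_Iic]
  congr 1
  ext ω
  simp only [Set.mem_preimage, Set.mem_Iic, Set.mem_ofPred_eq, hmean]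
  rw [inv_mul_le_iff₀ hsn, sub_le_iff_le_add']
  ring_nf

lemma irwinHall_div_factorial_mono {n : ℕ} (hn : 1 ≤ n) :
    Monotone fun x => irwinHall n x / n.factorial := by
  obtain ⟨Ω, mΩ, P, X, hX, hlaw, hindep, hP⟩ := exists_iid ℕ unitUniform
  intro x y hxy
  simp only [← measureReal_sum_le_eq_irwinHall hX hlaw hindep hn]
  exact measureReal_mono fun ω h => le_trans h hxy

end Distribution

section AsymptoticNormality

open ProbabilityTheory Filter Topology

/-- **Pólya's theorem**: pointwise convergence of distribution functions to a continuous
distribution function is uniform. -/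
lemma tendsto_iSup_abs_sub_of_monotone {f : ℕ → ℝ → ℝ} {F : ℝ → ℝ}
    (hf : ∀ᶠ n in atTop, Monotone (f n) ∧ ∀ x, f n x ∈ Set.Icc (0 : ℝ) 1)
    (hF : Monotone F) (hFc : Continuous F) (h0 : Tendsto F atBot (𝓝 0))
    (h1 : Tendsto F atTop (𝓝 1)) (h : ∀ x, Tendsto (fun n => f n x) atTop (𝓝 (F x))) :
    Tendsto (fun n => ⨆ x, |f n x - F x|) atTop (𝓝 0) := by
  have hF0 : ∀ x, 0 ≤ F x := fun x => hF.le_of_tendsto h0 x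
  have hF1 : ∀ x, F x ≤ 1 := fun x => hF.ge_of_tendsto h1 x
  rw [Metric.tendsto_atTop']
  suffices H : ∀ m : ℕ, 0 < m → ∀ᶠ n in atTop, ⨆ x, |f n x - F x| ≤ 3 / m by
    intro ε hε
    obtain ⟨m, hm⟩ := exists_nat_gt (3 / ε)
    have hm0 : (0 : ℝ) < m := (by positivity : 0 < 3 / ε).trans hm
    obtain ⟨N, hN⟩ := eventually_atTop.1 (H m (by exact_mod_cast hm0))
    refine ⟨N, fun n hn => ?_⟩
    rw [Real.dist_0_eq_abs, abs_of_nonneg (Real.iSup_nonneg fun _ => abs_nonneg _)]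
    exact (hN n hn.le).trans_lt ((div_lt_comm₀ hε hm0).1 hm)
  intro m hm
  have hm' : (0 : ℝ) < m := by exact_mod_cast hm
  have hp : ∀ i : ℕ, ∃ x, 0 < i → i < m → F x = i / m := by
    intro i
    by_cases hi : 0 < i ∧ i < m
    · have hi0 : (0 : ℝ) < i / m := div_pos (by exact_mod_cast hi.1) hm'
      have hi1 : (i : ℝ) / m < 1 := (div_lt_one hm').2 (by exact_mod_cast hi.2)
      obtain ⟨a, ha⟩ := (h0.eventually_lt_const hi0).exists
      obtain ⟨b, hb⟩ := (h1.eventually_const_lt hi1).exists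
      obtain ⟨x, hx⟩ := mem_range_of_exists_le_of_exists_ge hFc ⟨a, ha.le⟩ ⟨b, hb.le⟩
      exact ⟨x, fun _ _ => hx⟩
    · exact ⟨0, fun h h' => absurd ⟨h, h'⟩ hi⟩
  choose p hp using hp
  have hclose : ∀ᶠ n in atTop, ∀ i ∈ Finset.range m, |f n (p i) - F (p i)| < 1 / m :=
    (Filter.eventually_all_finset _).2 fun i _ => by
      simpa [Real.dist_eq] using (h (p i)).eventually (Metric.ball_mem_nhds _ (one_div_pos.2 hm'))
  filter_upwards [hf, hclose] with n ⟨hmono, hbd⟩ hn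
  refine Real.iSup_le (fun x => ?_) (by positivity)
  have hpt : ∀ k : ℕ, 0 < k → k < m → |m * f n (p k) - k| < 1 := by
    intro k hk hkm
    have := hn k (Finset.mem_range.2 hkm)
    rw [hp k hk hkm, lt_div_iff₀ hm', ← abs_of_pos hm', ← abs_mul, abs_of_pos hm'] at this
    rwa [sub_mul, div_mul_cancel₀ _ hm'.ne', mul_comm] at this
  rw [le_div_iff₀ hm', ← abs_of_pos hm', ← abs_mul, sub_mul, abs_le]
  have hi := Nat.floor_le (mul_nonneg hm'.le (hF0 x))
  have hi' := Nat.lt_floor_add_one ((m : ℝ) * F x)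
  set i := ⌊(m : ℝ) * F x⌋₊
  have hfm : f n x * m ≤ m := mul_le_of_le_one_left hm'.le (hbd x).2
  have hf0 : 0 ≤ f n x * m := mul_nonneg (hbd x).1 hm'.le
  have hcmp : ∀ k : ℕ, 0 < k → k < m → F (p k) * m = k := fun k hk hkm => by
    rw [hp k hk hkm, div_mul_cancel₀ _ hm'.ne']
  constructor
  · rcases le_or_gt i 1 with hi1 | hi1
    · have : (i : ℝ) ≤ 1 := by exact_mod_cast hi1
      linarith
    · have him : i ≤ m := by
        have : (i : ℝ) ≤ m := hi.trans (mul_le_of_le_one_right hm'.le (hF1 x))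
        exact_mod_cast this
      obtain ⟨k, hk⟩ : ∃ k, i = k + 1 := ⟨i - 1, by omega⟩
      rw [hk] at hi hi'
      push_cast at hi hi'
      have hlt : F (p k) < F x := by
        refine lt_of_mul_lt_mul_right ?_ hm'.le
        rw [hcmp k (by omega) (by omega)]
        linarith
      have hle := mul_le_mul_of_nonneg_right (hmono (hF.reflect_lt hlt).le) hm'.le
      have := (abs_lt.1 (hpt k (by omega) (by omega))).1
      linarith
  · rcases le_or_gt m (i + 1) with him | him
    · have : (m : ℝ) ≤ i + 1 := by exact_mod_cast him
      linarith
    · have hlt : F x < F (p (i + 1)) := by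
        refine lt_of_mul_lt_mul_right ?_ hm'.le
        rw [hcmp _ (by omega) him]
        push_cast
        linarith
      have hle := mul_le_mul_of_nonneg_right (hmono (hF.reflect_lt hlt).le) hm'.le
      have := (abs_lt.1 (hpt _ (by omega) him)).2
      push_cast at this
      linarith

/-- The Irwin–Hall distribution functions converge along any sequence of arguments whose
normalizations converge. -/
lemma tendsto_irwinHall_of_tendsto {y : ℕ → ℝ} {x : ℝ}
    (hy : Tendsto (fun n : ℕ => (y n - n / 2) / (√n / √12)) atTop (𝓝 x)) :
    Tendsto (fun n => irwinHall n (y n) / n.factorial) atTop (𝓝 (stdNormalCDF x)) := by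
  have hval : ∀ᶠ n : ℕ in atTop,
      y n = n / 2 + √n * (((y n - n / 2) / (√n / √12)) / √12) := by
    filter_upwards [eventually_ge_atTop 1] with n hn
    have : (0 : ℝ) < √n := by positivity
    field_simp
    ring
  have hmono : ∀ n : ℕ, Monotone fun z : ℝ => (n : ℝ) / 2 + √n * (z / √12) := by
    intro n a b hab
    dsimp only
    gcongr
  refine tendsto_order.2 ⟨fun a ha => ?_, fun a ha => ?_⟩
  · obtain ⟨z, hzx, hz⟩ : ∃ z < x, a < stdNormalCDF z :=
      (((continuous_stdNormalCDF.tendsto x).eventually_const_lt ha).filter_mono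
        nhdsWithin_le_nhds |>.and self_mem_nhdsWithin).exists (f := 𝓝[<] x) |>.imp fun _ h =>
          ⟨h.2, h.1⟩
    filter_upwards [hval, hy.eventually_const_lt hzx, (tendsto_irwinHall z).eventually_const_lt hz,
      eventually_ge_atTop 1] with n h1 h2 h3 hn
    refine h3.trans_le (irwinHall_div_factorial_mono hn ?_)
    rw [h1]
    exact hmono n h2.le
  · obtain ⟨z, hzx, hz⟩ : ∃ z > x, stdNormalCDF z < a :=
      (((continuous_stdNormalCDF.tendsto x).eventually_lt_const ha).filter_mono
        nhdsWithin_le_nhds |>.and self_mem_nhdsWithin).exists (f := 𝓝[>] x) |>.imp fun _ h =>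
          ⟨h.2, h.1⟩
    filter_upwards [hval, hy.eventually_lt_const hzx, (tendsto_irwinHall z).eventually_lt_const hz,
      eventually_ge_atTop 1] with n h1 h2 h3 hn
    refine (irwinHall_div_factorial_mono hn ?_).trans_lt h3
    rw [h1]
    exact hmono n h2.le

lemma irwinHall_nonneg {n : ℕ} (hn : 1 ≤ n) (x : ℝ) : 0 ≤ irwinHall n x := by
  have hfac : (0 : ℝ) < n.factorial := by positivity
  have := irwinHall_div_factorial_mono hn (min_le_left x 0)
  simp only [irwinHall_of_nonpos hn (min_le_right x 0), zero_div] at this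
  simpa using (le_div_iff₀ hfac).1 this

lemma irwinHall_mono {n : ℕ} (hn : 1 ≤ n) : Monotone (irwinHall n) := by
  intro x y hxy
  exact (div_le_div_iff_of_pos_right (by positivity)).1 (irwinHall_div_factorial_mono hn hxy)

lemma excSum_le_mem_Icc {n : ℕ} (hn : 1 ≤ n) (y : ℝ) :
    excSum n (fun e => if (e : ℝ) ≤ y then 1 else 0) ∈
      Set.Icc (irwinHall n y) (irwinHall n (y + 1)) := by
  rcases lt_or_ge y 0 with hy | hy
  · have : (fun e : ℕ => if (e : ℝ) ≤ y then (1 : ℝ) else 0) = fun _ => 0 := by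
      funext e
      exact if_neg (not_le.2 (hy.trans_le e.cast_nonneg))
    rw [this, irwinHall_of_nonpos hn hy.le]
    simp [excSum, irwinHall_nonneg hn]
  · have : (fun e : ℕ => if (e : ℝ) ≤ y then (1 : ℝ) else 0) =
        fun e => if e < ⌊y⌋₊ + 1 then 1 else 0 := by
      funext e
      simp only [← Nat.le_floor_iff hy, Nat.lt_succ_iff]
    rw [this, excSum_lt_eq_irwinHall hn]
    push_cast
    exact ⟨irwinHall_mono hn (Nat.lt_floor_add_one y).le,
      irwinHall_mono hn (by linarith [Nat.floor_le hy])⟩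

lemma tendsto_normalization (x b : ℝ) :
    Tendsto (fun n : ℕ => (x * √(((n : ℝ) + 1) / 12) + (n - 1) / 2 + b - n / 2) / (√n / √12))
      atTop (𝓝 x) := by
  have h1 : Tendsto (fun n : ℕ => √(((n : ℝ) + 1) / n)) atTop (𝓝 1) := by
    have : Tendsto (fun n : ℕ => ((n : ℝ) + 1) / n) atTop (𝓝 1) := by
      have := tendsto_one_div_atTop_nhds_zero_nat (𝕜 := ℝ) |>.const_add 1
      rw [add_zero] at this
      refine this.congr' ?_
      filter_upwards [eventually_ge_atTop 1] with n hn
      have : (n : ℝ) ≠ 0 := by positivity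
      field_simp
    simpa using this.sqrt
  have h2 : Tendsto (fun n : ℕ => (b - 1 / 2) * √12 / √(n : ℝ)) atTop (𝓝 0) :=
    tendsto_const_nhds.div_atTop (Real.tendsto_sqrt_atTop.comp tendsto_natCast_atTop_atTop)
  have h3 := (h1.const_mul x).add h2
  rw [mul_one, add_zero] at h3
  refine h3.congr' ?_
  filter_upwards [eventually_ge_atTop 1] with n hn
  have hn0 : (0 : ℝ) < √n := by positivity
  rw [Real.sqrt_div' _ (by positivity), Real.sqrt_div' _ (by positivity)]
  field_simp
  ring

lemma tendsto_excSum_le (x : ℝ) :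
    Tendsto (fun n : ℕ => excSum n (fun e => if (e : ℝ) ≤ x * √(((n : ℝ) + 1) / 12) + (n - 1) / 2
      then 1 else 0) / n.factorial) atTop (𝓝 (stdNormalCDF x)) := by
  have hlow := tendsto_irwinHall_of_tendsto (tendsto_normalization x 0)
  have hupp := tendsto_irwinHall_of_tendsto (tendsto_normalization x 1)
  simp only [add_zero] at hlow
  refine tendsto_of_tendsto_of_tendsto_of_le_of_le' hlow hupp ?_ ?_ <;>
    filter_upwards [eventually_ge_atTop 1] with n hn
  · exact div_le_div_of_nonneg_right (excSum_le_mem_Icc hn _).1 (by positivity)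
  · exact div_le_div_of_nonneg_right (excSum_le_mem_Icc hn _).2 (by positivity)

lemma tendsto_signedExcSum {f : ℕ → ℕ → ℝ} (hf : ∀ n k, |f n k| ≤ 1) :
    Tendsto (fun n => signedExcSum n (f n) / n.factorial) atTop (𝓝 0) := by
  refine squeeze_zero_norm' ?_ (FloorSemiring.tendsto_pow_div_factorial_atTop (2 : ℝ))
  filter_upwards [eventually_ge_atTop 1] with n hn
  obtain ⟨m, rfl⟩ := Nat.exists_eq_add_of_le' hn
  rw [norm_div, Real.norm_natCast, Real.norm_eq_abs]
  refine div_le_div_of_nonneg_right ((abs_signedExcSum_le m (hf _)).trans ?_) (by positivity)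
  exact pow_le_pow_right₀ one_le_two m.le_succ

section WeightedArray

variable {c : ℕ → ℕ → ℕ} {ε : ℝ}

lemma rowSum_eq_of_tsum
    (hc : ∀ n g, ∑' k, g k * (c n k : ℝ) = (excSum n g + ε * signedExcSum n g) / 2)
    {n : ℕ} (hn : 2 ≤ n) : rowSum c n = n.factorial / 2 := by
  have := hc n fun _ => 1
  rw [excSum_one, signedExcSum_one hn] at this
  simpa [rowSum] using this

lemma rowMean_eq_of_tsum
    (hc : ∀ n g, ∑' k, g k * (c n k : ℝ) = (excSum n g + ε * signedExcSum n g) / 2)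
    {n : ℕ} (hn : 3 ≤ n) : rowMean c n = ((n : ℝ) - 1) / 2 := by
  have hfac : (0 : ℝ) < n.factorial := by positivity
  rw [rowMean, hc n fun k => k, rowSum_eq_of_tsum hc (by omega), signedExcSum_id hn,
    excSum_id (by omega)]
  field_simp
  ring

lemma rowVar_eq_of_tsum
    (hc : ∀ n g, ∑' k, g k * (c n k : ℝ) = (excSum n g + ε * signedExcSum n g) / 2)
    {n : ℕ} (hn : 4 ≤ n) : rowVar c n = ((n : ℝ) + 1) / 12 := by
  have hfac : (0 : ℝ) < n.factorial := by positivity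
  rw [rowVar, hc n fun k => (k : ℝ) ^ 2, rowSum_eq_of_tsum hc (by omega),
    rowMean_eq_of_tsum hc (by omega), signedExcSum_sq hn, excSum_sq (by omega)]
  field_simp
  ring

lemma rowCDF_eq_of_tsum
    (hc : ∀ n g, ∑' k, g k * (c n k : ℝ) = (excSum n g + ε * signedExcSum n g) / 2)
    {n : ℕ} (hn : 2 ≤ n) (y : ℝ) :
    rowCDF c n y = excSum n (fun e => if (e : ℝ) ≤ y then 1 else 0) / n.factorial +
      ε * (signedExcSum n (fun e => if (e : ℝ) ≤ y then 1 else 0) / n.factorial) := by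
  have := hc n fun k => if (k : ℝ) ≤ y then 1 else 0
  simp only [ite_mul, one_mul, zero_mul] at this
  rw [rowCDF, this, rowSum_eq_of_tsum hc hn]
  have hfac : (0 : ℝ) < n.factorial := by positivity
  field_simp

lemma excSum_add_signedExcSum_mono (hε : |ε| ≤ 1) (n : ℕ) {f g : ℕ → ℝ} (hfg : ∀ k, f k ≤ g k) :
    excSum n f + ε * signedExcSum n f ≤ excSum n g + ε * signedExcSum n g := by
  have key : ∀ f : ℕ → ℝ, excSum n f + ε * signedExcSum n f =
      ∑ π : Equiv.Perm (Fin n), (1 + ε * ((Equiv.Perm.sign π : ℤ) : ℝ)) * f (excA π) := by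
    intro f
    rw [excSum, signedExcSum, Finset.mul_sum, ← Finset.sum_add_distrib]
    exact Finset.sum_congr rfl fun π _ => by ring
  rw [key, key]
  refine Finset.sum_le_sum fun π _ => mul_le_mul_of_nonneg_left (hfg _) ?_
  have := abs_le.1 hε
  rcases Int.units_eq_one_or (Equiv.Perm.sign π) with h | h <;> simp [h] <;> linarith

lemma rowCDF_monotone_mem_Icc_of_tsum
    (hc : ∀ n g, ∑' k, g k * (c n k : ℝ) = (excSum n g + ε * signedExcSum n g) / 2)
    (hε : |ε| ≤ 1) {n : ℕ} (hn : 2 ≤ n) :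
    Monotone (rowCDF c n) ∧ ∀ y, rowCDF c n y ∈ Set.Icc (0 : ℝ) 1 := by
  have hfac : (0 : ℝ) < n.factorial := by positivity
  have key : ∀ y, rowCDF c n y = (excSum n (fun e => if (e : ℝ) ≤ y then 1 else 0) +
      ε * signedExcSum n (fun e => if (e : ℝ) ≤ y then 1 else 0)) / n.factorial := fun y => by
    rw [rowCDF_eq_of_tsum hc hn, add_div, mul_div_assoc]
  refine ⟨fun x y hxy => ?_, fun y => ?_⟩
  · rw [key, key]
    refine div_le_div_of_nonneg_right (excSum_add_signedExcSum_mono hε n fun k => ?_) hfac.le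
    split_ifs <;> linarith
  · rw [key, Set.mem_Icc, le_div_iff₀ hfac, div_le_iff₀ hfac, zero_mul, one_mul]
    constructor
    · have := excSum_add_signedExcSum_mono hε n (f := fun _ => 0)
        (g := fun e => if (e : ℝ) ≤ y then 1 else 0) fun k => by split_ifs <;> norm_num
      simpa [excSum, signedExcSum] using this
    · have := excSum_add_signedExcSum_mono hε n (g := fun _ => 1)
        (f := fun e => if (e : ℝ) ≤ y then 1 else 0) fun k => by split_ifs <;> norm_num
      rwa [excSum_one, signedExcSum_one hn, mul_zero, add_zero] at this

lemma isAsympNormal_of_tsum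
    (hc : ∀ n g, ∑' k, g k * (c n k : ℝ) = (excSum n g + ε * signedExcSum n g) / 2)
    (hε : |ε| ≤ 1) : IsAsympNormal c := by
  have hcdf : stdNormalCDF = cdf (gaussianReal 0 1) := funext stdNormalCDF_eq_cdf
  refine tendsto_iSup_abs_sub_of_monotone
    (f := fun n x => rowCDF c n (x * √(rowVar c n) + rowMean c n)) ?_ ?_
    continuous_stdNormalCDF ?_ ?_ fun x => ?_
  · filter_upwards [eventually_ge_atTop 2] with n hn
    obtain ⟨hmono, hbd⟩ := rowCDF_monotone_mem_Icc_of_tsum hc hε hn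
    exact ⟨fun a b hab => hmono (by gcongr), fun _ => hbd _⟩
  · exact hcdf ▸ monotone_cdf _
  · exact hcdf ▸ tendsto_cdf_atBot _
  · exact hcdf ▸ tendsto_cdf_atTop _
  · have hsigned := tendsto_signedExcSum (f := fun n e =>
      if (e : ℝ) ≤ x * √(((n : ℝ) + 1) / 12) + (n - 1) / 2 then 1 else 0)
      fun n k => by split_ifs <;> simp
    have := (tendsto_excSum_le x).add (hsigned.const_mul ε)
    rw [mul_zero, add_zero] at this
    refine this.congr' ?_
    filter_upwards [eventually_ge_atTop 4] with n hn
    rw [rowVar_eq_of_tsum hc hn, rowMean_eq_of_tsum hc (by omega), rowCDF_eq_of_tsum hc (by omega)]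

end WeightedArray

end AsymptoticNormality

/-- Theorem: the coefficients of `AE_n^±(t)` are asymptotically normal; for `n ≥ 3` the mean
is `(n−1)/2` and for `n ≥ 4` the variance is `(n+1)/12`. -/
theorem clt_exc_plus_minus :
    IsAsympNormal cAEp ∧ IsAsympNormal cAEm ∧
    (∀ n : ℕ, 3 ≤ n →
      rowMean cAEp n = ((n : ℝ) - 1) / 2 ∧ rowMean cAEm n = ((n : ℝ) - 1) / 2) ∧
    (∀ n : ℕ, 4 ≤ n →
      rowVar cAEp n = ((n : ℝ) + 1) / 12 ∧ rowVar cAEm n = ((n : ℝ) + 1) / 12) := by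
  have hone : |(1 : ℝ)| ≤ 1 := by simp
  have hneg : |(-1 : ℝ)| ≤ 1 := by simp
  exact ⟨isAsympNormal_of_tsum tsum_mul_cAEp hone, isAsympNormal_of_tsum tsum_mul_cAEm hneg,
    fun _ hn => ⟨rowMean_eq_of_tsum tsum_mul_cAEp hn, rowMean_eq_of_tsum tsum_mul_cAEm hn⟩,
    fun _ hn => ⟨rowVar_eq_of_tsum tsum_mul_cAEp hn, rowVar_eq_of_tsum tsum_mul_cAEm hn⟩⟩
end

section
/- The distribution of the coefficients of D_n^±(t) is asymptotically normal as n → ∞. Moreover, for n ≥ 3 the mean of the coefficient distribution of D_n^±(t) equals n/2, and for n ≥ 4 its variance equals (n+2)/12. -/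
open scoped BigOperators


/-- A model of the hyperoctahedral group `B_n`: a signed permutation is a permutation of
`{1,...,n}` together with a sign for each position; `π_i = ±σ(i)`. -/
abbrev BG (n : ℕ) := Equiv.Perm (Fin n) × (Fin n → Bool)

/-- The value `π_{i+1} ∈ {−n,...,−1,1,...,n}` of a signed permutation at (0-indexed) position `i`. -/
def bval {n : ℕ} (π : BG n) (i : Fin n) : ℤ :=
  (if π.2 i then -1 else 1) * ((π.1 i : ℤ) + 1)

/-- The value `π_i` at 1-indexed position `i ∈ {1,...,n}`, with the convention `π_0 = 0`. -/
def bvalExt {n : ℕ} (π : BG n) (i : ℕ) : ℤ :=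
  if h : 1 ≤ i ∧ i ≤ n then bval π ⟨i - 1, by omega⟩ else 0

/-- `des_B(π) = |{i ∈ {0,...,n−1} : π_i > π_{i+1}}|` with `π_0 = 0`. -/
def desB {n : ℕ} (π : BG n) : ℕ :=
  ((Finset.range n).filter (fun i => bvalExt π (i + 1) < bvalExt π i)).card

/-- `asc_B(π) = n − des_B(π)`. -/
def ascB {n : ℕ} (π : BG n) : ℕ := n - desB π

/-- `negs(π) = |{i ∈ [n] : π_i < 0}|`. -/
def negs {n : ℕ} (π : BG n) : ℕ :=
  (Finset.univ.filter (fun i : Fin n => bval π i < 0)).card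

/-- `inv_A(π) = |{1 ≤ i < j ≤ n : π_i > π_j}|` (usual order on `ℤ`). -/
def invAB {n : ℕ} (π : BG n) : ℕ :=
  (Finset.univ.filter (fun p : Fin n × Fin n => p.1 < p.2 ∧ bval π p.2 < bval π p.1)).card

/-- `inv_D(π) = inv_A(π) + |{1 ≤ i < j ≤ n : −π_i > π_j}|`. -/
def invDB {n : ℕ} (π : BG n) : ℕ :=
  invAB π +
    (Finset.univ.filter (fun p : Fin n × Fin n => p.1 < p.2 ∧ bval π p.2 < -bval π p.1)).card

/-- `inv_B(π) = inv_A(π) + |{1 ≤ i < j ≤ n : −π_i > π_j}| + negs(π)`. -/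
def invBB {n : ℕ} (π : BG n) : ℕ := invDB π + negs π

/-- `exc_B(π) = |{i ∈ [n] : π_{|π_i|} > π_i}| + |{i ∈ [n] : π_i = −i}|`. -/
def excB {n : ℕ} (π : BG n) : ℕ :=
  (Finset.univ.filter (fun i : Fin n => bval π i < bvalExt π (bval π i).natAbs)).card +
    (Finset.univ.filter (fun i : Fin n => bval π i = -((i : ℤ) + 1))).card

/-- The value `π_i` at position `i`, with the type D convention `π_0 = −π_2`. -/
def dvalExt {n : ℕ} (π : BG n) (i : ℕ) : ℤ :=
  if i = 0 then -bvalExt π 2 else bvalExt π i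

/-- `des_D(π) = |{i ∈ {0,...,n−1} : π_i > π_{i+1}}|` with `π_0 = −π_2`. -/
def desD {n : ℕ} (π : BG n) : ℕ :=
  ((Finset.range n).filter (fun i => dvalExt π (i + 1) < dvalExt π i)).card

/-- Number of `π ∈ D_n^+` with `des_D(π) = k`. -/
def cDDesP (n k : ℕ) : ℕ :=
  (Finset.univ.filter
    (fun π : BG n => Even (negs π) ∧ Even (invDB π) ∧ desD π = k)).card

/-- Number of `π ∈ D_n^-` with `des_D(π) = k`. -/
def cDDesM (n k : ℕ) : ℕ :=
  (Finset.univ.filter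
    (fun π : BG n => Even (negs π) ∧ ¬ Even (invDB π) ∧ desD π = k)).card

section

open MeasureTheory ProbabilityTheory Filter Topology

/-- The number of descents of a finite word. -/
def wordDes {α : Type*} [LinearOrder α] {m : ℕ} (g : Fin (m + 1) → α) : ℕ :=
  (Finset.univ.filter (fun i : Fin m => g i.succ < g i.castSucc)).card

instance isProbabilityMeasure_unitAddCircle :
    IsProbabilityMeasure (volume : Measure UnitAddCircle) :=
  ⟨UnitAddCircle.measure_univ⟩

/-- The representative in `[0, 1)` of a point of the circle. -/
noncomputable def circleFrac (x : UnitAddCircle) : ℝ := (AddCircle.equivIco 1 0 x : ℝ)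

lemma circleFrac_nonneg (x : UnitAddCircle) : 0 ≤ circleFrac x :=
  (AddCircle.equivIco 1 0 x).2.1

lemma circleFrac_lt_one (x : UnitAddCircle) : circleFrac x < 1 := by
  exact (AddCircle.equivIco (1 : ℝ) 0 x).2.2.trans_eq (zero_add 1)

lemma circleFrac_injective : Function.Injective circleFrac :=
  Subtype.val_injective.comp (AddCircle.equivIco 1 0).injective

lemma measurable_circleFrac : Measurable circleFrac :=
  measurable_subtype_coe.comp (AddCircle.measurableEquivIco 1 0).measurable

lemma coe_circleFrac (x : UnitAddCircle) : ((circleFrac x : ℝ) : UnitAddCircle) = x :=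
  AddCircle.coe_equivIco

lemma circleFrac_coe (x : ℝ) : circleFrac (x : UnitAddCircle) = Int.fract x := by
  have := AddCircle.coe_equivIco_mk_apply (p := (1 : ℝ)) x
  rw [circleFrac, this, div_one, mul_one]

lemma circleFrac_sub (x y : UnitAddCircle) :
    circleFrac (x - y) =
      circleFrac x - circleFrac y + if circleFrac x < circleFrac y then 1 else 0 := by
  have h : x - y = ((circleFrac x - circleFrac y : ℝ) : UnitAddCircle) := by
    rw [AddCircle.coe_sub, coe_circleFrac, coe_circleFrac]
  rw [h, circleFrac_coe]
  have hx := circleFrac_nonneg x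
  have hy := circleFrac_nonneg y
  have hx' := circleFrac_lt_one x
  have hy' := circleFrac_lt_one y
  split_ifs with hlt
  · rw [← Int.fract_add_one, Int.fract_eq_self]
    constructor <;> linarith
  · rw [add_zero, Int.fract_eq_self]
    constructor <;> linarith

lemma integral_circle_eq (f : ℝ → ℝ) :
    ∫ x : UnitAddCircle, f (circleFrac x) = ∫ x in (0 : ℝ)..1, f x := by
  have h := UnitAddCircle.intervalIntegral_preimage 0 (fun x => f (circleFrac x))
  rw [← h, zero_add]
  refine intervalIntegral.integral_congr_ae ?_
  have h1 : ∀ᵐ x : ℝ, x ≠ 1 := by simp [ae_iff, measure_singleton]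
  filter_upwards [h1] with x hx hm
  rw [Set.uIoc_of_le zero_le_one] at hm
  rw [circleFrac_coe, Int.fract_eq_self.2 ⟨hm.1.le, lt_of_le_of_ne hm.2 hx⟩]

/-- The consecutive differences of a word in the circle, starting with its first letter. -/
noncomputable def circleDiff (m : ℕ) :
    (Fin (m + 1) → UnitAddCircle) →+ (Fin (m + 1) → UnitAddCircle) where
  toFun v := Fin.cons (v 0) (fun i : Fin m => v i.succ - v i.castSucc)
  map_zero' := by ext i; refine Fin.cases ?_ (fun i => ?_) i <;> simp
  map_add' u v := by
    ext i
    refine Fin.cases ?_ (fun i => ?_) i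
    · simp
    · simp only [Fin.cons_succ, Pi.add_apply]; abel

lemma measurePreserving_circleDiff (m : ℕ) : MeasurePreserving (circleDiff m) volume volume := by
  refine AddMonoidHom.measurePreserving ?_ ?_ rfl
  · refine continuous_pi fun i => ?_
    refine Fin.cases ?_ (fun i => ?_) i
    · exact continuous_apply 0
    · exact (continuous_apply i.succ).sub (continuous_apply i.castSucc)
  · intro u
    refine ⟨fun i => Fin.induction (motive := fun _ => UnitAddCircle) (u 0)
      (fun i x => x + u i.succ) i, ?_⟩
    ext i
    refine Fin.cases ?_ (fun i => ?_) i
    · simp [circleDiff]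
    · simp [circleDiff]

lemma sum_circleFrac_circleDiff {m : ℕ} (v : Fin (m + 1) → UnitAddCircle) :
    ∑ i, circleFrac (circleDiff m v i) =
      circleFrac (v (Fin.last m)) + wordDes (fun i => circleFrac (v i)) := by
  have tele : ∀ (k : ℕ) (a : Fin (k + 1) → ℝ),
      ∑ i : Fin k, (a i.succ - a i.castSucc) = a (Fin.last k) - a 0 := by
    intro k
    induction k with
    | zero => intro a; simp
    | succ k ih =>
      intro a
      rw [Fin.sum_univ_castSucc]
      have := ih (fun i => a i.castSucc)
      simp only [Fin.castSucc_zero] at this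
      simp only [Fin.succ_castSucc] at *
      rw [this, Fin.succ_last]; ring
  rw [Fin.sum_univ_succ]
  simp only [circleDiff, AddMonoidHom.coe_mk, ZeroHom.coe_mk, Fin.cons_zero, Fin.cons_succ,
    circleFrac_sub, Finset.sum_add_distrib]
  rw [tele m (fun i => circleFrac (v i)), wordDes, Finset.sum_boole]
  ring

lemma ae_injective_circle (m : ℕ) :
    ∀ᵐ v : Fin (m + 1) → UnitAddCircle, Function.Injective v := by
  have key : ∀ i j : Fin (m + 1), i ≠ j →
      ∀ᵐ v : Fin (m + 1) → UnitAddCircle, v i ≠ v j := by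
    intro i j hij
    let φ : (Fin (m + 1) → UnitAddCircle) →+ UnitAddCircle :=
      Pi.evalAddMonoidHom (fun _ => UnitAddCircle) i -
        Pi.evalAddMonoidHom (fun _ => UnitAddCircle) j
    have hφ : ∀ v, φ v = v i - v j := fun v => rfl
    have hmp : MeasurePreserving φ volume volume := by
      refine AddMonoidHom.measurePreserving ?_ ?_ ?_
      · exact (continuous_apply i).sub (continuous_apply j)
      · intro x
        refine ⟨Pi.single i x, ?_⟩
        simp [hφ, hij.symm]
      · rw [measure_univ, measure_univ]
    have h0 : ∀ᵐ x : UnitAddCircle, x ≠ 0 := by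
      have := AddCircle.volume_closedBall 1 (x := 0) 0
      simpa [ae_iff] using this
    filter_upwards [hmp.quasiMeasurePreserving.ae h0] with v hv hvv
    exact hv (by rw [hφ, hvv, sub_self])
  have : ∀ᵐ v : Fin (m + 1) → UnitAddCircle, ∀ i j, i ≠ j → v i ≠ v j := by
    rw [ae_all_iff]; intro i
    rw [ae_all_iff]; intro j
    by_cases h : i = j
    · simp [h]
    · filter_upwards [key i j h] with v hv _ using hv
  filter_upwards [this] with v hv i j hij
  by_contra hne
  exact hv i j hne hij

lemma wordDes_comp_strictMono {α β : Type*} [LinearOrder α] [LinearOrder β] {m : ℕ}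
    {f : α → β} (hf : StrictMono f) (g : Fin (m + 1) → α) :
    wordDes (fun i => f (g i)) = wordDes g := by
  simp [wordDes, hf.lt_iff_lt]

/-- The number of permutations with at most `y` descents. -/
noncomputable def permDesCount (m : ℕ) (y : ℝ) : ℕ :=
  (Finset.univ.filter (fun σ : Equiv.Perm (Fin (m + 1)) => (wordDes σ : ℝ) ≤ y)).card

lemma card_wordDes_comp_perm {α : Type*} [LinearOrder α] {m : ℕ} {g : Fin (m + 1) → α}
    (hg : Function.Injective g) (y : ℝ) :
    (Finset.univ.filter (fun σ : Equiv.Perm (Fin (m + 1)) =>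
      (wordDes (fun i => g (σ i)) : ℝ) ≤ y)).card = permDesCount m y := by
  have hcard : (Finset.univ.image g).card = m + 1 := by
    rw [Finset.card_image_of_injective _ hg]; simp
  let e := (Finset.univ.image g).orderIsoOfFin hcard
  let ρ₀ : Fin (m + 1) → Fin (m + 1) := fun i => e.symm ⟨g i, by simp⟩
  have hρ₀ : Function.Injective ρ₀ := by
    intro i j hij
    have := e.symm.injective hij
    simpa using hg (by simpa using this)
  let ρ : Equiv.Perm (Fin (m + 1)) := Equiv.ofBijective ρ₀ (Finite.injective_iff_bijective.1 hρ₀)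
  have hg' : ∀ i, g i = (e (ρ i) : α) := by
    intro i; simp [ρ, ρ₀]
  have hmono : StrictMono (fun k => (e k : α)) := fun a b hab => e.strictMono hab
  rw [permDesCount]
  refine Finset.card_bij (fun σ _ => ρ * σ) ?_ ?_ ?_
  · intro σ hσ
    simp only [Finset.mem_filter, Finset.mem_univ, true_and, hg'] at hσ ⊢
    rw [wordDes_comp_strictMono hmono] at hσ
    exact hσ
  · intro σ _ τ _ h
    exact mul_left_cancel h
  · intro τ hτ
    refine ⟨ρ⁻¹ * τ, ?_, by simp⟩
    simp only [Finset.mem_filter, Finset.mem_univ, true_and, hg'] at hτ ⊢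
    rw [wordDes_comp_strictMono hmono]
    simpa using hτ

lemma measurableSet_wordDes_le (m : ℕ) (y : ℝ) :
    MeasurableSet {v : Fin (m + 1) → UnitAddCircle |
      (wordDes (fun i => circleFrac (v i)) : ℝ) ≤ y} := by
  refine measurableSet_le ?_ measurable_const
  simp only [wordDes, ← Finset.sum_boole]
  refine Finset.measurable_fun_sum _ fun i _ => ?_
  refine Measurable.ite ?_ measurable_const measurable_const
  exact measurableSet_lt (measurable_circleFrac.comp (measurable_pi_apply _))
    (measurable_circleFrac.comp (measurable_pi_apply _))

lemma measureReal_wordDes_le (m : ℕ) (y : ℝ) :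
    (volume : Measure (Fin (m + 1) → UnitAddCircle)).real
      {v | (wordDes (fun i => circleFrac (v i)) : ℝ) ≤ y} =
      permDesCount m y / (m + 1).factorial := by
  set A := {v : Fin (m + 1) → UnitAddCircle | (wordDes (fun i => circleFrac (v i)) : ℝ) ≤ y}
    with hA
  have hAm : MeasurableSet A := measurableSet_wordDes_le m y
  have hperm : ∀ σ : Equiv.Perm (Fin (m + 1)),
      MeasurePreserving (fun v : Fin (m + 1) → UnitAddCircle => fun i => v (σ i))
        volume volume := by
    intro σ
    let φ : (Fin (m + 1) → UnitAddCircle) →+ (Fin (m + 1) → UnitAddCircle) :=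
      { toFun := fun v i => v (σ i), map_zero' := rfl, map_add' := fun _ _ => rfl }
    refine AddMonoidHom.measurePreserving (f := φ) ?_ ?_ rfl
    · exact continuous_pi fun i => continuous_apply (σ i)
    · intro u
      exact ⟨fun i => u (σ⁻¹ i), by ext i; simp [φ]⟩
  have h1 : ∀ σ : Equiv.Perm (Fin (m + 1)),
      ∫ v : Fin (m + 1) → UnitAddCircle, A.indicator (fun _ => (1 : ℝ)) (fun i => v (σ i)) =
        volume.real A := by
    intro σ
    have := integral_map (μ := volume) (hperm σ).measurable.aemeasurable
      (f := A.indicator (fun _ => (1 : ℝ)))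
      (((measurable_const.indicator hAm)).aestronglyMeasurable)
    rw [(hperm σ).map_eq] at this
    rw [← this, integral_indicator_const _ hAm, smul_eq_mul, mul_one]
  have h2 : ∫ v : Fin (m + 1) → UnitAddCircle, ∑ σ : Equiv.Perm (Fin (m + 1)),
      A.indicator (fun _ => (1 : ℝ)) (fun i => v (σ i)) = permDesCount m y := by
    have : ∀ᵐ v : Fin (m + 1) → UnitAddCircle, ∑ σ : Equiv.Perm (Fin (m + 1)),
        A.indicator (fun _ => (1 : ℝ)) (fun i => v (σ i)) = permDesCount m y := by
      filter_upwards [ae_injective_circle m] with v hv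
      rw [← card_wordDes_comp_perm (circleFrac_injective.comp hv) y, ← Finset.sum_boole]
      refine Finset.sum_congr rfl fun σ _ => ?_
      simp [Set.indicator_apply, hA]
    rw [integral_congr_ae this]
    simp
  rw [integral_finsetSum] at h2
  · simp only [h1, Finset.sum_const, Finset.card_univ, Fintype.card_perm, Fintype.card_fin,
      nsmul_eq_mul] at h2
    rw [eq_div_iff (by positivity), mul_comm, h2]
  · intro σ _
    have : Integrable (A.indicator (fun _ => (1 : ℝ)))
        (volume : Measure (Fin (m + 1) → UnitAddCircle)) :=
      (integrable_const 1).indicator hAm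
    exact (hperm σ).integrable_comp_of_integrable this

/-- The distribution function of a sum of `n` independent uniform variables on `[0, 1)`. -/
noncomputable def uniformSumCDF (n : ℕ) (y : ℝ) : ℝ :=
  (Measure.infinitePi (fun _ : ℕ => (volume : Measure UnitAddCircle))).real
    {ω | ∑ k ∈ Finset.range n, circleFrac (ω k) ≤ y}

lemma uniformSumCDF_eq (m : ℕ) (y : ℝ) :
    uniformSumCDF (m + 1) y = (volume : Measure (Fin (m + 1) → UnitAddCircle)).real
      {u | ∑ i, circleFrac (u i) ≤ y} := by
  have hmap := Measure.map_infinitePi_infinitePi_of_inj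
    (P := fun _ : ℕ => (volume : Measure UnitAddCircle)) (Fin.val_injective (n := m + 1))
  rw [Measure.infinitePi_eq_pi (ι := Fin (m + 1)), ← volume_pi] at hmap
  have hm : MeasurableSet {u : Fin (m + 1) → UnitAddCircle | ∑ i, circleFrac (u i) ≤ y} := by
    refine measurableSet_le (Finset.measurable_fun_sum _ fun i _ => ?_) measurable_const
    exact measurable_circleFrac.comp (measurable_pi_apply _)
  rw [← hmap, map_measureReal_apply (by fun_prop) hm, uniformSumCDF]
  congr 1
  ext ω
  simp [Finset.sum_range]

lemma uniformSumCDF_eq_wordDes (m : ℕ) (y : ℝ) :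
    uniformSumCDF (m + 1) y = (volume : Measure (Fin (m + 1) → UnitAddCircle)).real
      {v | circleFrac (v (Fin.last m)) + wordDes (fun i => circleFrac (v i)) ≤ y} := by
  have hm : MeasurableSet {u : Fin (m + 1) → UnitAddCircle | ∑ i, circleFrac (u i) ≤ y} := by
    refine measurableSet_le (Finset.measurable_fun_sum _ fun i _ => ?_) measurable_const
    exact measurable_circleFrac.comp (measurable_pi_apply _)
  rw [uniformSumCDF_eq,
    ← (measurePreserving_circleDiff m).measureReal_preimage hm.nullMeasurableSet]
  simp only [Set.preimage_ofPred_eq, sum_circleFrac_circleDiff]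

lemma uniformSumCDF_le_permDes (m : ℕ) (y : ℝ) :
    uniformSumCDF (m + 1) y ≤ permDesCount m y / (m + 1).factorial := by
  rw [uniformSumCDF_eq_wordDes, ← measureReal_wordDes_le]
  refine measureReal_mono fun v hv => ?_
  have := circleFrac_nonneg (v (Fin.last m))
  simp only [Set.mem_ofPred_eq] at hv ⊢
  linarith

lemma permDes_le_uniformSumCDF (m : ℕ) (y : ℝ) :
    (permDesCount m y : ℝ) / (m + 1).factorial ≤ uniformSumCDF (m + 1) (y + 1) := by
  rw [uniformSumCDF_eq_wordDes, ← measureReal_wordDes_le]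
  refine measureReal_mono fun v hv => ?_
  have := circleFrac_lt_one (v (Fin.last m))
  simp only [Set.mem_ofPred_eq] at hv ⊢
  linarith

lemma tendsto_normalized_uniformSum (z : ℝ) :
    Tendsto (fun n : ℕ =>
      (Measure.infinitePi (fun _ : ℕ => (volume : Measure UnitAddCircle))).real
        {ω | (√n)⁻¹ * ∑ k ∈ Finset.range n, √12 * (circleFrac (ω k) - 1 / 2) ≤ z})
      atTop (𝓝 (stdNormalCDF z)) := by
  set P := Measure.infinitePi (fun _ : ℕ => (volume : Measure UnitAddCircle))
  set f : UnitAddCircle → ℝ := fun x => √12 * (circleFrac x - 1 / 2)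
  have hf : Measurable f := (measurable_circleFrac.sub_const _).const_mul _
  let X : ℕ → (ℕ → UnitAddCircle) → ℝ := fun k ω => f (ω k)
  have hX : ∀ k, Measurable (X k) := fun k => hf.comp (measurable_pi_apply k)
  have hint : ∀ (g : ℝ → ℝ), Measurable g →
      ∫ ω, g (circleFrac (ω 0)) ∂P = ∫ x in (0 : ℝ)..1, g x := by
    intro g hg
    have hmp : MeasurePreserving (fun ω : ℕ → UnitAddCircle => ω 0) P volume :=
      measurePreserving_eval_infinitePi _ 0
    rw [← integral_circle_eq, ← hmp.map_eq, integral_map hmp.measurable.aemeasurable]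
    exact (hg.comp measurable_circleFrac).aestronglyMeasurable
  have hclt := tendstoInDistribution_inv_sqrt_mul_sum (P := P) (X := X)
    (P' := gaussianReal 0 1) (Y := id) HasLaw.id ?_ ?_ ?_ ?_
  · have hfr : (gaussianReal 0 1) (frontier (Set.Iic z)) = 0 := by
      have : NullSingletonClass (gaussianReal 0 1) :=
        nullSingletonClass_gaussianReal one_ne_zero
      rw [frontier_Iic, measure_singleton]
    have h := ProbabilityMeasure.tendsto_measure_of_null_frontier_of_tendsto' hclt.tendsto
      (E := Set.Iic z) (by simpa using hfr)
    simp only [ProbabilityMeasure.coe_mk, Measure.map_id] at h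
    have h2 := (ENNReal.tendsto_toReal (measure_ne_top (gaussianReal 0 1) _)).comp h
    rw [stdNormalCDF_eq_cdf, cdf_eq_real]
    convert h2 using 1
    · ext n
      simp only [Function.comp]
      rw [Measure.map_apply (by fun_prop) measurableSet_Iic]
      rfl
    · simp [measureReal_def]
  · simp only [X, f]
    rw [hint (fun x => √12 * (x - 1 / 2)) (by fun_prop)]
    norm_num [integral_id]
  · simp only [X, f, Pi.pow_apply]
    rw [hint (fun x => (√12 * (x - 1 / 2)) ^ 2) (by fun_prop)]
    simp only [mul_pow]
    rw [Real.sq_sqrt (by norm_num), intervalIntegral.integral_const_mul,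
      intervalIntegral.integral_comp_sub_right (fun x => x ^ 2) (1 / 2), integral_pow]
    norm_num
  · exact iIndepFun_infinitePi (X := fun _ => f) (fun _ => hf)
  · intro k
    refine ⟨(hX k).aemeasurable, (hX 0).aemeasurable, ?_⟩
    have h : ∀ j, P.map (X j) = (volume : Measure UnitAddCircle).map f := by
      intro j
      rw [← (measurePreserving_eval_infinitePi (fun _ : ℕ => (volume : Measure UnitAddCircle))
        j).map_eq, Measure.map_map hf (measurable_pi_apply j)]
      rfl
    rw [h, h]

lemma tendsto_of_monotone_of_tendsto {F : ℕ → ℝ → ℝ} {G : ℝ → ℝ} (hF : ∀ n, Monotone (F n))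
    (hG : Continuous G) (h : ∀ z, Tendsto (fun n => F n z) atTop (𝓝 (G z))) {z : ℕ → ℝ} {x : ℝ}
    (hz : Tendsto z atTop (𝓝 x)) : Tendsto (fun n => F n (z n)) atTop (𝓝 (G x)) := by
  rw [Metric.tendsto_atTop']
  intro ε hε
  obtain ⟨δ, hδ, hGδ⟩ := Metric.continuous_iff.1 hG x (ε / 2) (by positivity)
  have hlow := hGδ (x - δ / 2) (by rw [Real.dist_eq, abs_lt]; constructor <;> linarith)
  have hupp := hGδ (x + δ / 2) (by rw [Real.dist_eq, abs_lt]; constructor <;> linarith)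
  have e1 := Metric.tendsto_nhds.1 (h (x - δ / 2)) (ε / 2) (by positivity)
  have e2 := Metric.tendsto_nhds.1 (h (x + δ / 2)) (ε / 2) (by positivity)
  have e3 := Metric.tendsto_nhds.1 hz (δ / 2) (by positivity)
  obtain ⟨N, hN⟩ := eventually_atTop.1 (e1.and (e2.and e3))
  refine ⟨N, fun n hn => ?_⟩
  obtain ⟨h1, h2, h3⟩ := hN n hn.le
  rw [Real.dist_eq, abs_lt] at *
  have m1 := hF n (show x - δ / 2 ≤ z n by linarith)
  have m2 := hF n (show z n ≤ x + δ / 2 by linarith)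
  constructor <;> linarith

lemma tendsto_uniformSumCDF {y : ℕ → ℝ} {x : ℝ}
    (hy : Tendsto (fun n : ℕ => (√n)⁻¹ * (√12 * (y n - n / 2))) atTop (𝓝 x)) :
    Tendsto (fun n => uniformSumCDF n (y n)) atTop (𝓝 (stdNormalCDF x)) := by
  have hmono : ∀ n : ℕ, Monotone fun z : ℝ =>
      (Measure.infinitePi (fun _ : ℕ => (volume : Measure UnitAddCircle))).real
        {ω | (√n)⁻¹ * ∑ k ∈ Finset.range n, √12 * (circleFrac (ω k) - 1 / 2) ≤ z} :=
    fun n a b hab => measureReal_mono fun ω hω => le_trans (b := a) hω hab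
  have h := tendsto_of_monotone_of_tendsto hmono
    continuous_stdNormalCDF tendsto_normalized_uniformSum hy
  refine h.congr' ?_
  filter_upwards [eventually_gt_atTop 0] with n hn
  rw [uniformSumCDF]
  congr 1
  ext ω
  have h1 : 0 < (√(n : ℝ))⁻¹ := by positivity
  have h2 : (0 : ℝ) < √12 := by positivity
  simp only [Set.mem_ofPred_eq]
  rw [mul_le_mul_iff_right₀ h1, ← Finset.mul_sum, mul_le_mul_iff_right₀ h2]
  simp only [Finset.sum_sub_distrib, Finset.sum_const, Finset.card_range, nsmul_eq_mul]
  rw [mul_one_div, sub_le_sub_iff_right]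

lemma monotone_stdNormalCDF : Monotone stdNormalCDF := by
  rw [funext stdNormalCDF_eq_cdf]
  exact monotone_cdf _

lemma tendsto_stdNormalCDF_atBot : Tendsto stdNormalCDF atBot (𝓝 0) := by
  rw [funext stdNormalCDF_eq_cdf]
  exact tendsto_cdf_atBot _

lemma tendsto_stdNormalCDF_atTop : Tendsto stdNormalCDF atTop (𝓝 1) := by
  rw [funext stdNormalCDF_eq_cdf]
  exact tendsto_cdf_atTop _

/-- Pólya's theorem: distribution functions converging pointwise to a continuous one converge
uniformly. -/
lemma tendsto_iSup_abs_sub_of_monotone_s5 {F : ℕ → ℝ → ℝ} {G : ℝ → ℝ} (hF : ∀ n, Monotone (F n))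
    (hF0 : ∀ n x, 0 ≤ F n x) (hF1 : ∀ n x, F n x ≤ 1) (hGm : Monotone G) (hG : Continuous G)
    (hbot : Tendsto G atBot (𝓝 0)) (htop : Tendsto G atTop (𝓝 1))
    (hlim : ∀ z, Tendsto (fun n => F n z) atTop (𝓝 (G z))) :
    Tendsto (fun n => ⨆ x, |F n x - G x|) atTop (𝓝 0) := by
  have hG0 : ∀ x, 0 ≤ G x := hGm.le_of_tendsto hbot
  have hG1 : ∀ x, G x ≤ 1 := hGm.ge_of_tendsto htop
  have hsurj : ∀ c : ℝ, 0 < c → c < 1 → ∃ x, G x = c := by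
    intro c h0 h1
    obtain ⟨a, ha⟩ := (hbot.eventually_le_const h0).exists
    obtain ⟨b, hb⟩ := (htop.eventually_const_le h1).exists
    exact mem_range_of_exists_le_of_exists_ge hG ⟨a, ha⟩ ⟨b, hb⟩
  rw [Metric.tendsto_nhds]
  intro ε hε
  obtain ⟨K, hK⟩ := exists_nat_gt (3 / (ε / 2))
  have hK0 : (0 : ℝ) < K := lt_trans (by positivity) hK
  have hKε : 3 / (K : ℝ) < ε / 2 := by
    rw [div_lt_iff₀ (by positivity)] at hK ⊢
    linarith
  have hgrid : ∀ j : ℕ, ∃ x, 0 < j → j < K → G x = j / K := by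
    intro j
    by_cases hj : 0 < j ∧ j < K
    · obtain ⟨x, hx⟩ := hsurj (j / K) (div_pos (by exact_mod_cast hj.1) hK0)
        (by rw [div_lt_one hK0]; exact_mod_cast hj.2)
      exact ⟨x, fun _ _ => hx⟩
    · exact ⟨0, fun h h' => absurd ⟨h, h'⟩ hj⟩
  choose p hp using hgrid
  have hev : ∀ᶠ n in atTop, ∀ j ∈ Finset.range K, |F n (p j) - G (p j)| < 1 / K := by
    rw [Filter.eventually_all_finset]
    intro j _
    exact Metric.tendsto_nhds.1 (hlim (p j)) _ (by positivity)
  filter_upwards [hev] with n hn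
  have hbound : ∀ x, |F n x - G x| ≤ 3 / K := by
    intro x
    obtain ⟨j, hj⟩ : ∃ j : ℕ, j = ⌊K * G x⌋₊ := ⟨_, rfl⟩
    have hj1 : (j : ℝ) ≤ K * G x := hj ▸ Nat.floor_le (by have := hG0 x; positivity)
    have hj2 : K * G x < j + 1 := hj ▸ Nat.lt_floor_add_one _
    have g1 := hF0 n x
    have g2 := hF1 n x
    rw [abs_le, neg_le, neg_sub, sub_le_iff_le_add, sub_le_iff_le_add]
    have e1 : G x = K * G x / K := by field_simp
    rw [e1]
    constructor
    · rcases Nat.lt_or_ge j 2 with h | h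
      · have : (j : ℝ) ≤ 1 := by exact_mod_cast Nat.le_of_lt_succ h
        have : K * G x / K ≤ 3 / K := by gcongr; linarith
        linarith
      · obtain ⟨i, rfl⟩ : ∃ i, j = i + 1 := ⟨j - 1, by omega⟩
        have hiK : i < K := by
          have : K * G x ≤ K := by nlinarith [hG1 x]
          have : ((i + 1 : ℕ) : ℝ) ≤ K := hj1.trans this
          exact_mod_cast this
        have hpi := hp i (by omega) hiK
        have hle : p i ≤ x := by
          by_contra! hlt
          have := hGm hlt.le
          rw [hpi, le_div_iff₀ hK0] at this
          push_cast at hj1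
          linarith
        have hFi := hF n hle
        have hc := (abs_lt.1 (hn i (Finset.mem_range.2 hiK))).1
        rw [hpi] at hc
        push_cast at hj2
        have : K * G x / K ≤ (i + 2) / K := by gcongr; linarith
        have e : ((i : ℝ) + 2) / K = 3 / K + (i / K - 1 / K) := by ring
        linarith
    · rcases Nat.lt_or_ge (j + 1) K with h | h
      · have hpi := hp (j + 1) (by omega) h
        have hle : x ≤ p (j + 1) := by
          by_contra! hlt
          have := hGm hlt.le
          rw [hpi, div_le_iff₀ hK0] at this
          push_cast at this
          linarith
        have hFi := hF n hle
        have hc := (abs_lt.1 (hn (j + 1) (Finset.mem_range.2 h))).2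
        rw [hpi] at hc
        have : (j : ℝ) / K ≤ K * G x / K := by gcongr
        have e : ((j + 1 : ℕ) : ℝ) / K = j / K + 1 / K := by push_cast; ring
        have e3 : 3 / (K : ℝ) = 1 / K + 1 / K + 1 / K := by ring
        have : (0 : ℝ) < 1 / K := by positivity
        linarith
      · have hK1 : (K : ℝ) ≤ j + 1 := by exact_mod_cast h
        have : 1 ≤ 3 / K + K * G x / K := by
          rw [← add_div, le_div_iff₀ hK0]
          linarith
        linarith
  rw [Real.dist_eq, sub_zero, abs_of_nonneg (Real.iSup_nonneg fun _ => abs_nonneg _)]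
  exact lt_of_le_of_lt (ciSup_le hbound) (by linarith)

lemma tsum_mul_card_filter_eq {ι : Type*} (S : Finset ι) (d : ι → ℕ) (h : ℕ → ℝ) :
    ∑' k, h k * ((S.filter (fun x => d x = k)).card : ℝ) = ∑ x ∈ S, h (d x) := by
  rw [Finset.sum_comp h d, tsum_eq_sum (s := S.image d)]
  · simp [mul_comm]
  · intro k hk
    rw [Finset.filter_eq_empty_iff.2, Finset.card_empty, Nat.cast_zero, mul_zero]
    intro x hx hxk
    exact hk (Finset.mem_image.2 ⟨x, hx, hxk⟩)

/-- The product of the signs of a signed permutation. -/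
def signProd {n : ℕ} (ε : Fin n → Bool) : ℤˣ := ∏ i, if ε i then -1 else 1

lemma bval_neg_iff {n : ℕ} (π : BG n) (i : Fin n) : bval π i < 0 ↔ π.2 i = true := by
  unfold bval
  split_ifs with h <;> simp [h] <;> omega

lemma even_negs_iff {n : ℕ} (π : BG n) : Even (negs π) ↔ signProd π.2 = 1 := by
  rw [negs, signProd, Finset.prod_ite]
  simp only [Finset.prod_const, one_pow, mul_one, bval_neg_iff]
  exact (neg_one_pow_eq_one_iff_even (by decide)).symm

lemma neg_one_pow_invDB {n : ℕ} (π : BG n) : (-1 : ℤˣ) ^ invDB π = Equiv.Perm.sign π.1 := by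
  have key : ∀ p : Fin n × Fin n, p.1 < p.2 →
      ((if bval π p.2 < bval π p.1 then -1 else 1) * (if bval π p.2 < -bval π p.1 then -1 else 1)
        : ℤˣ) = if π.1 p.1 < π.1 p.2 then 1 else -1 := by
    intro p hp
    have hne : (π.1 p.1 : ℕ) ≠ π.1 p.2 := fun h =>
      hp.ne (π.1.injective (Fin.ext h))
    have hlt : π.1 p.1 < π.1 p.2 ↔ (π.1 p.1 : ℕ) < π.1 p.2 := Iff.rfl
    simp only [hlt]
    unfold bval
    generalize (π.1 p.1 : ℕ) = a at *
    generalize (π.1 p.2 : ℕ) = b at *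
    cases π.2 p.1 <;> cases π.2 p.2 <;> simp only [if_true, if_false, Bool.false_eq_true] <;>
      split_ifs <;> first | rfl | omega
  have hsum : ∀ (P Q : Fin n × Fin n → Prop) [DecidablePred P] [DecidablePred Q],
      (-1 : ℤˣ) ^ (Finset.univ.filter (fun p => P p ∧ Q p)).card =
        ∏ p ∈ Finset.univ.filter P, if Q p then -1 else 1 := by
    intro P Q _ _
    rw [Finset.prod_ite]
    simp [Finset.filter_filter]
  rw [invDB, invAB, pow_add, hsum, hsum, ← Finset.prod_mul_distrib,
    Finset.prod_congr rfl (fun p hp => key p (Finset.mem_filter.1 hp).2),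
    Equiv.Perm.sign_eq_prod_prod_Ioi, Finset.prod_sigma']
  refine Finset.prod_bij' (fun p _ => ⟨p.1, p.2⟩) (fun p _ => (p.1, p.2)) ?_ ?_ ?_ ?_ ?_ <;> simp

lemma even_invDB_iff {n : ℕ} (π : BG n) : Even (invDB π) ↔ Equiv.Perm.sign π.1 = 1 := by
  rw [← neg_one_pow_invDB]
  exact (neg_one_pow_eq_one_iff_even (by decide)).symm

/-- The signed permutations whose underlying permutation has sign `a` and whose signs have
product `b`. -/
def sgnClass (n : ℕ) (a b : ℤˣ) : Finset (BG n) :=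
  Finset.univ.filter (fun π => Equiv.Perm.sign π.1 = a ∧ signProd π.2 = b)

lemma cDDesP_eq (n k : ℕ) :
    cDDesP n k = ((sgnClass n 1 1).filter (fun π => desD π = k)).card := by
  rw [cDDesP, sgnClass, Finset.filter_filter]
  congr 1
  ext π
  simp only [Finset.mem_filter, even_negs_iff, even_invDB_iff]
  tauto

lemma cDDesM_eq (n k : ℕ) :
    cDDesM n k = ((sgnClass n (-1) 1).filter (fun π => desD π = k)).card := by
  have h : ∀ u : ℤˣ, ¬u = 1 ↔ u = -1 := by decide
  rw [cDDesM, sgnClass, Finset.filter_filter]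
  congr 1
  ext π
  simp only [Finset.mem_filter, even_negs_iff, even_invDB_iff, h]
  tauto

/-- Permute the positions of a signed permutation by `τ` and then negate the entries marked
by `δ`. -/
def signedAct {n : ℕ} (τ : Equiv.Perm (Fin n)) (δ : Fin n → Bool) (π : BG n) : BG n :=
  (π.1 * τ, fun i => xor (π.2 (τ i)) (δ i))

lemma bval_signedAct {n : ℕ} (τ : Equiv.Perm (Fin n)) (δ : Fin n → Bool) (π : BG n) (i : Fin n) :
    bval (signedAct τ δ π) i = (if δ i then -1 else 1) * bval π (τ i) := by
  simp only [bval, signedAct, Equiv.Perm.mul_apply]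
  by_cases hε : π.2 (τ i) <;> by_cases hδ : δ i <;> simp [hε, hδ]

lemma signProd_signedAct {n : ℕ} (τ : Equiv.Perm (Fin n)) (δ : Fin n → Bool) (π : BG n) :
    signProd (signedAct τ δ π).2 = signProd π.2 * signProd δ := by
  unfold signProd signedAct
  rw [← Equiv.prod_comp τ (fun i => if π.2 i then (-1 : ℤˣ) else 1), ← Finset.prod_mul_distrib]
  refine Finset.prod_congr rfl fun i _ => ?_
  cases hε : π.2 (τ i) <;> cases hδ : δ i <;> simp [hε, hδ]

lemma sum_signedAct {M : Type*} [AddCommMonoid M] {n : ℕ} (φ : BG n → M)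
    (τ : Equiv.Perm (Fin n)) (δ : Fin n → Bool) (a b : ℤˣ) :
    ∑ π ∈ sgnClass n a b, φ (signedAct τ δ π) =
      ∑ π ∈ sgnClass n (a * Equiv.Perm.sign τ) (b * signProd δ), φ π := by
  have hinv : ∀ π : BG n, signedAct τ δ (signedAct τ⁻¹ (fun i => δ (τ⁻¹ i)) π) = π := by
    intro π
    ext i <;> simp [signedAct]
  have hinv' : ∀ π : BG n, signedAct τ⁻¹ (fun i => δ (τ⁻¹ i)) (signedAct τ δ π) = π := by
    intro π
    ext i <;> simp [signedAct]
  have hmem : ∀ π : BG n, signedAct τ δ π ∈ sgnClass n (a * Equiv.Perm.sign τ) (b * signProd δ) ↔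
      π ∈ sgnClass n a b := by
    intro π
    simp only [sgnClass, Finset.mem_filter, signProd_signedAct, mul_left_inj]
    simp [signedAct]
  refine Finset.sum_bij' (fun π _ => signedAct τ δ π)
    (fun π _ => signedAct τ⁻¹ (fun i => δ (τ⁻¹ i)) π) (fun π h => (hmem π).2 h) ?_
    (fun π _ => hinv' π) (fun π _ => hinv π) (fun _ _ => rfl)
  intro π hπ
  rwa [← hmem, hinv]

/-- The marks supported on `s`. -/
def markOn {n : ℕ} (s : Finset (Fin n)) (i : Fin n) : Bool := decide (i ∈ s)

lemma signProd_markOn {n : ℕ} (s : Finset (Fin n)) : signProd (markOn s) = (-1) ^ s.card := by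
  simp [signProd, markOn]

lemma sum_signedAct_of_even {M : Type*} [AddCommMonoid M] {n : ℕ} (φ : BG n → M)
    {τ : Equiv.Perm (Fin n)} {s : Finset (Fin n)} (hτ : Equiv.Perm.sign τ = 1)
    (hs : Even s.card) (a b : ℤˣ) :
    ∑ π ∈ sgnClass n a b, φ (signedAct τ (markOn s) π) = ∑ π ∈ sgnClass n a b, φ π := by
  rw [sum_signedAct, hτ, signProd_markOn, hs.neg_one_pow, mul_one, mul_one]

lemma sum_eq_half_of_signedAct {n : ℕ} {φ ψ : BG n → ℝ}
    {τ : Equiv.Perm (Fin n)} {s : Finset (Fin n)} (hτ : Equiv.Perm.sign τ = 1)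
    (hs : Even s.card) (h : ∀ π, φ π + φ (signedAct τ (markOn s) π) = ψ π) (a b : ℤˣ) :
    ∑ π ∈ sgnClass n a b, φ π = (∑ π ∈ sgnClass n a b, ψ π) / 2 := by
  simp_rw [← h]
  rw [Finset.sum_add_distrib, sum_signedAct_of_even φ hτ hs]
  ring

/-- Indicator of a descent between the entries at positions `p` and `q`. -/
def desInd {n : ℕ} (p q : Fin n) (π : BG n) : ℝ := if bval π q < bval π p then 1 else 0

/-- Indicator of the event that the entries at positions `p` and `q` have negative sum. -/
def negSumInd {n : ℕ} (p q : Fin n) (π : BG n) : ℝ := if bval π p < -bval π q then 1 else 0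

lemma bval_ne {n : ℕ} (π : BG n) {p q : Fin n} (h : p ≠ q) : bval π p ≠ bval π q := by
  have : (π.1 p : ℕ) ≠ π.1 q := fun h' => h (π.1.injective (Fin.ext h'))
  unfold bval
  split_ifs <;> omega

lemma bval_ne_neg {n : ℕ} (π : BG n) {p q : Fin n} (h : p ≠ q) : bval π p ≠ -bval π q := by
  have : (π.1 p : ℕ) ≠ π.1 q := fun h' => h (π.1.injective (Fin.ext h'))
  unfold bval
  split_ifs <;> omega

lemma ite_lt_add_ite_lt {x y : ℤ} (h : x ≠ y) :
    (if x < y then (1 : ℝ) else 0) + (if y < x then 1 else 0) = 1 := by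
  rcases h.lt_or_gt with h | h <;> simp [h, h.not_gt]

lemma desInd_add_desInd {n : ℕ} (π : BG n) {p q : Fin n} (h : p ≠ q) :
    desInd p q π + desInd q p π = 1 := ite_lt_add_ite_lt (bval_ne π h.symm)

section moments

variable {n : ℕ} {p q r s : Fin n} (a b : ℤˣ)

lemma desInd_markOn_pair (π : BG n) : desInd p q (signedAct 1 (markOn {p, q}) π) = desInd q p π := by
  simp [desInd, bval_signedAct, markOn]

lemma desInd_markOn_of_notMem {t : Finset (Fin n)} (hp : p ∉ t) (hq : q ∉ t) (π : BG n) :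
    desInd p q (signedAct 1 (markOn t) π) = desInd p q π := by
  simp [desInd, bval_signedAct, markOn, hp, hq]

lemma negSumInd_markOn_pair (hpq : p ≠ q) (π : BG n) :
    negSumInd p q π + negSumInd p q (signedAct 1 (markOn {p, q}) π) = 1 := by
  rw [← ite_lt_add_ite_lt (bval_ne_neg π hpq)]
  simp [negSumInd, bval_signedAct, markOn, neg_lt]

lemma sum_desInd (hpq : p ≠ q) :
    ∑ π ∈ sgnClass n a b, desInd p q π = ((sgnClass n a b).card : ℝ) / 2 := by
  rw [sum_eq_half_of_signedAct (τ := 1) (s := {p, q}) (ψ := fun _ => 1) (by simp)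
    (by simp [Finset.card_pair hpq])]
  · simp
  · intro π
    rw [desInd_markOn_pair, desInd_add_desInd π hpq]

lemma sum_negSumInd (hpq : p ≠ q) :
    ∑ π ∈ sgnClass n a b, negSumInd p q π = ((sgnClass n a b).card : ℝ) / 2 := by
  rw [sum_eq_half_of_signedAct (τ := 1) (s := {p, q}) (ψ := fun _ => 1) (by simp)
    (by simp [Finset.card_pair hpq])]
  · simp
  · exact negSumInd_markOn_pair hpq

lemma sum_desInd_mul_desInd (h : [p, q, r, s].Nodup) :
    ∑ π ∈ sgnClass n a b, desInd p q π * desInd r s π = ((sgnClass n a b).card : ℝ) / 4 := by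
  simp only [List.nodup_cons, List.mem_cons, List.not_mem_nil, not_or, or_false] at h
  obtain ⟨⟨h1, h2, h3⟩, ⟨h4, h5⟩, h6, -⟩ := h
  rw [sum_eq_half_of_signedAct (τ := 1) (s := {p, q}) (ψ := desInd r s) (by simp)
    (by simp [Finset.card_pair h1]), sum_desInd a b h6]
  · ring
  · intro π
    rw [desInd_markOn_pair, desInd_markOn_of_notMem, ← add_mul, desInd_add_desInd π h1, one_mul]
    · simp [Ne.symm h2, Ne.symm h4]
    · simp [Ne.symm h3, Ne.symm h5]

lemma sum_negSumInd_mul_desInd (h : [p, q, r, s].Nodup) :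
    ∑ π ∈ sgnClass n a b, negSumInd p q π * desInd r s π = ((sgnClass n a b).card : ℝ) / 4 := by
  simp only [List.nodup_cons, List.mem_cons, List.not_mem_nil, not_or, or_false] at h
  obtain ⟨⟨h1, h2, h3⟩, ⟨h4, h5⟩, h6, -⟩ := h
  rw [sum_eq_half_of_signedAct (τ := 1) (s := {p, q}) (ψ := desInd r s) (by simp)
    (by simp [Finset.card_pair h1]), sum_desInd a b h6]
  · ring
  · intro π
    rw [desInd_markOn_of_notMem (by simp [Ne.symm h2, Ne.symm h4])
      (by simp [Ne.symm h3, Ne.symm h5]), ← add_mul, negSumInd_markOn_pair h1, one_mul]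

lemma sum_negSumInd_mul_desInd_self (h : [p, q, r, s].Nodup) :
    ∑ π ∈ sgnClass n a b, negSumInd p q π * desInd p q π = ((sgnClass n a b).card : ℝ) / 4 := by
  simp only [List.nodup_cons, List.mem_cons, List.not_mem_nil, not_or, or_false] at h
  obtain ⟨⟨h1, h2, h3⟩, ⟨h4, h5⟩, h6, -⟩ := h
  rw [sum_eq_half_of_signedAct (τ := Equiv.swap p q * Equiv.swap r s) (s := ∅)
    (ψ := negSumInd p q) (by simp [h1, h6]) (by simp),
    sum_negSumInd a b h1]
  · ring
  · intro π
    have e1 : Equiv.swap r s p = p := Equiv.swap_apply_of_ne_of_ne h2 h3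
    have e2 : Equiv.swap r s q = q := Equiv.swap_apply_of_ne_of_ne h4 h5
    have f1 : desInd p q (signedAct (Equiv.swap p q * Equiv.swap r s) (markOn ∅) π) =
        desInd q p π := by
      simp [desInd, bval_signedAct, markOn, e1, e2]
    have f2 : negSumInd p q (signedAct (Equiv.swap p q * Equiv.swap r s) (markOn ∅) π) =
        negSumInd p q π := by
      simp [negSumInd, bval_signedAct, markOn, e1, e2, lt_neg]
    rw [f1, f2, ← mul_add, desInd_add_desInd π h1, mul_one]

lemma sum_desInd_mul_desInd_adjacent (h : [p, q, r, s].Nodup) :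
    ∑ π ∈ sgnClass n a b, desInd p q π * desInd q r π = ((sgnClass n a b).card : ℝ) / 6 := by
  simp only [List.nodup_cons, List.mem_cons, List.not_mem_nil, not_or, or_false] at h
  obtain ⟨⟨h1, h2, h3⟩, ⟨h4, h5⟩, h6, -⟩ := h
  have hcard : Even (({p, q, r, s} : Finset (Fin n)).card) := by
    rw [Finset.card_insert_of_notMem (by simp [h1, h2, h3]),
      Finset.card_insert_of_notMem (by simp [h4, h5]), Finset.card_pair h6]
    decide
  set τ := Equiv.swap p q * Equiv.swap q r with hτ
  have τp : τ p = q := by simp [hτ, Equiv.swap_apply_of_ne_of_ne h1 h2]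
  have τq : τ q = r := by
    simp [hτ, Equiv.swap_apply_of_ne_of_ne (Ne.symm h2) (Ne.symm h4)]
  have τr : τ r = p := by simp [hτ]
  have hs : Equiv.Perm.sign τ = 1 := by simp [hτ, h1, h4]
  have hs2 : Equiv.Perm.sign (τ * τ) = 1 := by simp [hs]
  set φ : BG n → ℝ := fun π => desInd p q π * desInd q r π with hφ
  have key : ∀ π : BG n, φ π + φ (signedAct τ (markOn ∅) π) + φ (signedAct (τ * τ) (markOn ∅) π) +
      (φ (signedAct 1 (markOn {p, q, r, s}) π) + φ (signedAct τ (markOn {p, q, r, s}) π) +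
        φ (signedAct (τ * τ) (markOn {p, q, r, s}) π)) = 1 := by
    intro π
    simp only [hφ, desInd, bval_signedAct, markOn, Equiv.Perm.mul_apply, τp, τq, τr]
    simp only [Finset.mem_insert, Finset.notMem_empty, decide_false, Bool.false_eq_true, if_false,
      true_or, or_true, decide_true, if_true, neg_one_mul, neg_lt_neg_iff, one_mul,
      Equiv.Perm.one_apply]
    have n1 := bval_ne π h1
    have n2 := bval_ne π h2
    have n3 := bval_ne π h4
    generalize bval π p = x at *
    generalize bval π q = y at *
    generalize bval π r = z at *
    rcases n1.lt_or_gt with k1 | k1 <;> rcases n2.lt_or_gt with k2 | k2 <;>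
      rcases n3.lt_or_gt with k3 | k3 <;> first
        | omega
        | simp [k1, k2, k3, k1.not_gt, k2.not_gt, k3.not_gt]
  have hsum := Finset.sum_congr (rfl : sgnClass n a b = sgnClass n a b) (fun π _ => key π)
  simp only [Finset.sum_add_distrib] at hsum
  rw [sum_signedAct_of_even φ hs (by simp), sum_signedAct_of_even φ hs2 (by simp),
    sum_signedAct_of_even φ (by simp) hcard, sum_signedAct_of_even φ hs hcard,
    sum_signedAct_of_even φ hs2 hcard] at hsum
  simp only [Finset.sum_const, nsmul_eq_mul, mul_one] at hsum
  linarith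

lemma card_sgnClass_neg (p : Fin n) (a b : ℤˣ) :
    (sgnClass n a (-b)).card = (sgnClass n a b).card := by
  have := sum_signedAct (fun _ => 1) 1 (markOn {p}) a b
  simpa [signProd_markOn] using this.symm

lemma card_sgnClass_neg_left (hpq : p ≠ q) (a b : ℤˣ) :
    (sgnClass n (-a) b).card = (sgnClass n a b).card := by
  have := sum_signedAct (fun _ => 1) (Equiv.swap p q) (markOn ∅) a b
  simpa [signProd_markOn, Equiv.Perm.sign_swap hpq] using this.symm

lemma sum_negSumInd_mul_desInd_adjacent (h : [p, q, r, s].Nodup) :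
    ∑ π ∈ sgnClass n a b, negSumInd p q π * desInd q r π = ((sgnClass n a b).card : ℝ) / 6 := by
  have h' := h
  simp only [List.nodup_cons, List.mem_cons, List.not_mem_nil, not_or, or_false] at h'
  obtain ⟨⟨h1, h2, h3⟩, ⟨h4, h5⟩, h6, -⟩ := h'
  have := sum_signedAct (fun π => negSumInd p q π * desInd q r π) 1 (markOn {p}) a (-b)
  simp only [Equiv.Perm.sign_one, mul_one, signProd_markOn, Finset.card_singleton, pow_one,
    mul_neg, neg_neg] at this
  rw [← this, ← card_sgnClass_neg p, ← sum_desInd_mul_desInd_adjacent a (-b) h]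
  refine Finset.sum_congr rfl fun π _ => ?_
  rw [desInd_markOn_of_notMem (by simp [Ne.symm h1]) (by simp [Ne.symm h2])]
  simp [negSumInd, desInd, bval_signedAct, markOn, Ne.symm h1]

end moments

/-- Indicator of the type D descent at `i`. -/
def desDInd {n : ℕ} (i : ℕ) (π : BG n) : ℝ := if dvalExt π (i + 1) < dvalExt π i then 1 else 0

lemma desD_eq_sum {n : ℕ} (π : BG n) : (desD π : ℝ) = ∑ i ∈ Finset.range n, desDInd i π := by
  simp [desD, desDInd]

lemma bvalExt_add_one {n i : ℕ} (hi : i < n) (π : BG n) : bvalExt π (i + 1) = bval π ⟨i, hi⟩ := by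
  rw [bvalExt, dif_pos ⟨by omega, by omega⟩]
  rfl

lemma desDInd_zero {n : ℕ} (hn : 2 ≤ n) (π : BG n) :
    desDInd 0 π = negSumInd ⟨0, by omega⟩ ⟨1, by omega⟩ π := by
  rw [desDInd, negSumInd, ← bvalExt_add_one (by omega), ← bvalExt_add_one (by omega)]
  rfl

lemma desDInd_succ {n j : ℕ} (hj : j + 1 < n) (π : BG n) :
    desDInd (j + 1) π = desInd ⟨j, by omega⟩ ⟨j + 1, hj⟩ π := by
  rw [desDInd, desInd, ← bvalExt_add_one (by omega), ← bvalExt_add_one (by omega)]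
  rfl

lemma sum_desDInd {n i : ℕ} (hn : 2 ≤ n) (hi : i < n) (a b : ℤˣ) :
    ∑ π ∈ sgnClass n a b, desDInd i π = ((sgnClass n a b).card : ℝ) / 2 := by
  rcases i with _ | j
  · simp only [desDInd_zero hn]
    exact sum_negSumInd a b (by simp)
  · simp only [desDInd_succ hi]
    exact sum_desInd a b (by simp)

/-- The joint probability of type D descents at `i` and `j`. -/
noncomputable def descentPairProb (i j : ℕ) : ℝ :=
  if i = j then 1 / 2
  else if (1 ≤ i ∧ j = i + 1) ∨ (1 ≤ j ∧ i = j + 1) ∨ (i = 0 ∧ j = 2) ∨ (i = 2 ∧ j = 0) then 1 / 6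
  else 1 / 4

lemma descentPairProb_comm (i j : ℕ) : descentPairProb i j = descentPairProb j i := by
  unfold descentPairProb
  split_ifs <;> first | rfl | omega

lemma sum_desDInd_mul_desDInd {n i j : ℕ} (hn : 4 ≤ n) (hi : i < n) (hj : j < n) (a b : ℤˣ) :
    ∑ π ∈ sgnClass n a b, desDInd i π * desDInd j π =
      (sgnClass n a b).card * descentPairProb i j := by
  wlog hij : i ≤ j generalizing i j
  · rw [descentPairProb_comm, ← this hj hi (le_of_not_ge hij)]
    exact Finset.sum_congr rfl fun _ _ => mul_comm _ _
  rcases hij.eq_or_lt with rfl | hij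
  · have : ∀ π : BG n, desDInd i π * desDInd i π = desDInd i π := by
      intro π; unfold desDInd; split_ifs <;> simp
    simp only [this, sum_desDInd (by omega : 2 ≤ n) hi, descentPairProb, if_true]
    ring
  obtain ⟨k, rfl⟩ : ∃ k, j = k + 1 := ⟨j - 1, by omega⟩
  rcases i with _ | i
  · simp only [desDInd_zero (by omega : 2 ≤ n), desDInd_succ hj]
    rcases k with _ | _ | k
    · rw [sum_negSumInd_mul_desInd_self a b (r := ⟨2, by omega⟩) (s := ⟨3, by omega⟩) (by simp)]
      norm_num [descentPairProb]
      ring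
    · rw [sum_negSumInd_mul_desInd_adjacent a b (s := ⟨3, by omega⟩) (by simp)]
      norm_num [descentPairProb]
      ring
    · rw [sum_negSumInd_mul_desInd a b (by simp), descentPairProb, if_neg (by omega),
        if_neg (by omega)]
      ring
  · simp only [desDInd_succ hi, desDInd_succ hj]
    rcases Nat.lt_or_ge (i + 1) k with hik | hik
    · rw [sum_desInd_mul_desInd a b (by simp; omega), descentPairProb, if_neg (by omega),
        if_neg (by omega)]
      ring
    · obtain rfl : k = i + 1 := by omega
      rw [descentPairProb, if_neg (by omega), if_pos (by omega)]
      rcases i with _ | i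
      · rw [sum_desInd_mul_desInd_adjacent a b (s := ⟨3, by omega⟩) (by simp)]
        ring
      · rw [sum_desInd_mul_desInd_adjacent a b (s := ⟨0, by omega⟩) (by simp)]
        ring

lemma sum_descentPairProb {n : ℕ} (hn : 3 ≤ n) :
    ∑ i ∈ Finset.range n, ∑ j ∈ Finset.range n, descentPairProb i j =
      (n : ℝ) ^ 2 / 4 + (n + 2) / 12 := by
  induction n, hn using Nat.le_induction with
  | base =>
    norm_num [Finset.sum_range_succ, descentPairProb]
  | succ n hn ih =>
    have h : ∑ i ∈ Finset.range n, descentPairProb i n = n / 4 - 1 / 12 := by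
      have : ∀ i ∈ Finset.range n, descentPairProb i n =
          1 / 4 - if i = n - 1 then 1 / 12 else 0 := by
        intro i hi
        have := Finset.mem_range.1 hi
        rw [descentPairProb, if_neg (by omega)]
        split_ifs <;> first | omega | norm_num
      rw [Finset.sum_congr rfl this, Finset.sum_sub_distrib, Finset.sum_ite_eq',
        if_pos (Finset.mem_range.2 (by omega))]
      simp
      ring
    have h' : ∑ j ∈ Finset.range n, descentPairProb n j = n / 4 - 1 / 12 := by
      rw [← h]
      exact Finset.sum_congr rfl fun j _ => descentPairProb_comm n j
    rw [Finset.sum_range_succ, Finset.sum_congr rfl (fun i _ => Finset.sum_range_succ _ n),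
      Finset.sum_add_distrib, ih, h, Finset.sum_range_succ, h', descentPairProb, if_pos rfl]
    push_cast
    ring

lemma sum_univ_eq_sum_sgnClass {M : Type*} [AddCommMonoid M] {n : ℕ} (φ : BG n → M) :
    ∑ π, φ π = ∑ a : ℤˣ, ∑ b : ℤˣ, ∑ π ∈ sgnClass n a b, φ π := by
  rw [← Finset.sum_product', ← Finset.sum_fiberwise Finset.univ
    (fun π : BG n => (Equiv.Perm.sign π.1, signProd π.2)) φ]
  refine Finset.sum_congr rfl fun c _ => Finset.sum_congr ?_ fun _ _ => rfl
  ext π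
  simp [sgnClass, Prod.ext_iff]

lemma four_mul_card_sgnClass {n : ℕ} (hn : 2 ≤ n) (a b : ℤˣ) :
    4 * (sgnClass n a b).card = 2 ^ n * n.factorial := by
  have h := sum_univ_eq_sum_sgnClass (fun _ : BG n => 1)
  have hu : ∀ u v : ℤˣ, u = v ∨ u = -v := by decide
  have hab : ∀ a' b', (sgnClass n a' b').card = (sgnClass n a b).card := by
    intro a' b'
    have e := card_sgnClass_neg (⟨0, by omega⟩ : Fin n)
    have f := card_sgnClass_neg_left (p := (⟨0, by omega⟩ : Fin n)) (q := ⟨1, by omega⟩) (by simp)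
    rcases hu a' a with rfl | rfl <;> rcases hu b' b with rfl | rfl <;> simp only [e, f]
  simp only [Finset.sum_const, hab] at h
  simp [Fintype.card_perm] at h
  linarith

lemma rowSum_eq {c : ℕ → ℕ → ℕ} {n : ℕ} {a b : ℤˣ}
    (hc : ∀ k, c n k = ((sgnClass n a b).filter (fun π => desD π = k)).card) :
    rowSum c n = (sgnClass n a b).card := by
  have := tsum_mul_card_filter_eq (sgnClass n a b) desD (fun _ => 1)
  simpa [rowSum, hc] using this

lemma rowMean_eq {c : ℕ → ℕ → ℕ} {n : ℕ} {a b : ℤˣ}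
    (hc : ∀ k, c n k = ((sgnClass n a b).filter (fun π => desD π = k)).card) (hn : 2 ≤ n) :
    rowMean c n = n / 2 := by
  have hpos : (0 : ℝ) < (sgnClass n a b).card := by
    have := four_mul_card_sgnClass hn a b
    have : 0 < 2 ^ n * n.factorial := by positivity
    exact_mod_cast (by omega : 0 < (sgnClass n a b).card)
  rw [rowMean, rowSum_eq hc]
  simp only [hc]
  rw [tsum_mul_card_filter_eq _ desD (fun k => (k : ℝ))]
  simp only [desD_eq_sum]
  rw [Finset.sum_comm, Finset.sum_congr rfl (fun i hi => sum_desDInd hn (Finset.mem_range.1 hi) a b)]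
  simp
  field_simp

lemma rowVar_eq {c : ℕ → ℕ → ℕ} {n : ℕ} {a b : ℤˣ}
    (hc : ∀ k, c n k = ((sgnClass n a b).filter (fun π => desD π = k)).card) (hn : 4 ≤ n) :
    rowVar c n = (n + 2) / 12 := by
  have hpos : (0 : ℝ) < (sgnClass n a b).card := by
    have := four_mul_card_sgnClass (by omega : 2 ≤ n) a b
    have : 0 < 2 ^ n * n.factorial := by positivity
    exact_mod_cast (by omega : 0 < (sgnClass n a b).card)
  rw [rowVar, rowMean_eq hc (by omega), rowSum_eq hc]
  simp only [hc]
  rw [tsum_mul_card_filter_eq _ desD (fun k => (k : ℝ) ^ 2)]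
  simp only [desD_eq_sum, sq (∑ i ∈ _, _), Finset.sum_mul_sum]
  rw [Finset.sum_comm]
  have : ∀ i ∈ Finset.range n, ∑ π ∈ sgnClass n a b,
      ∑ j ∈ Finset.range n, desDInd i π * desDInd j π =
      (sgnClass n a b).card * ∑ j ∈ Finset.range n, descentPairProb i j := by
    intro i hi
    rw [Finset.sum_comm, Finset.mul_sum]
    exact Finset.sum_congr rfl fun j hj => sum_desDInd_mul_desDInd hn (Finset.mem_range.1 hi)
      (Finset.mem_range.1 hj) a b
  rw [Finset.sum_congr rfl this, ← Finset.mul_sum, sum_descentPairProb (by omega)]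
  field_simp
  ring

lemma wordDes_le_add_two {m : ℕ} {u v : Fin (m + 1) → ℤ}
    (h : ∀ i : Fin (m + 1), 2 ≤ (i : ℕ) → u i = v i) :
    wordDes u ≤ wordDes v + 2 := by
  classical
  have hsub : Finset.univ.filter (fun i : Fin m => u i.succ < u i.castSucc) ⊆
      Finset.univ.filter (fun i : Fin m => v i.succ < v i.castSucc) ∪
        Finset.univ.filter (fun i : Fin m => (i : ℕ) ∈ Finset.range 2) := by
    intro i hi
    simp only [Finset.mem_union, Finset.mem_filter, Finset.mem_univ, true_and, Finset.mem_range]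
      at hi ⊢
    by_cases h2 : (i : ℕ) < 2
    · exact Or.inr h2
    · left
      rwa [← h i.succ (by simp; omega), ← h i.castSucc (by simp; omega)]
  have hcard : (Finset.univ.filter (fun i : Fin m => (i : ℕ) ∈ Finset.range 2)).card ≤ 2 := by
    calc _ ≤ (Finset.range 2).card := Finset.card_le_card_of_injOn (fun i : Fin m => (i : ℕ))
            (by intro i hi; simpa using hi) (Fin.val_injective.injOn)
      _ = 2 := Finset.card_range 2
  exact (Finset.card_le_card hsub).trans ((Finset.card_union_le _ _).trans (by
    unfold wordDes; omega))

lemma desD_eq_wordDes_add {m : ℕ} (π : BG (m + 1)) :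
    desD π = wordDes (bval π) + if dvalExt π 1 < dvalExt π 0 then 1 else 0 := by
  rw [desD, wordDes, Finset.card_filter, Finset.sum_range_succ', Finset.card_filter,
    Finset.sum_range]
  congr 1
  refine Finset.sum_congr rfl fun i _ => ?_
  have h1 : dvalExt π (i + 1 + 1) = bval π i.succ := bvalExt_add_one (by omega) π
  have h2 : dvalExt π (i + 1) = bval π i.castSucc := bvalExt_add_one (by omega) π
  rw [h1, h2]

/-- The number of signed permutations of a class with at most `y` descents as words. -/
noncomputable def classWordCount (m : ℕ) (a b : ℤˣ) (y : ℝ) : ℕ :=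
  ((sgnClass (m + 1) a b).filter (fun π => (wordDes (bval π) : ℝ) ≤ y)).card

lemma classWordCount_le {m : ℕ} (hm : 1 ≤ m) (a b a' b' : ℤˣ) (y : ℝ) :
    classWordCount m a b y ≤ classWordCount m a' b' (y + 2) := by
  have hu : ∀ u v : ℤˣ, v = u ∨ v = -u := by decide
  have h01 : (⟨0, by omega⟩ : Fin (m + 1)) ≠ ⟨1, by omega⟩ := by simp
  have hne : ∀ i : Fin (m + 1), 2 ≤ (i : ℕ) → i ≠ ⟨0, by omega⟩ ∧ i ≠ ⟨1, by omega⟩ := fun i hi =>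
    ⟨Fin.ne_of_val_ne (by dsimp only; omega), Fin.ne_of_val_ne (by dsimp only; omega)⟩
  obtain ⟨τ, hτ, hτs⟩ : ∃ τ : Equiv.Perm (Fin (m + 1)), (∀ i : Fin (m + 1), 2 ≤ (i : ℕ) → τ i = i) ∧
      a * Equiv.Perm.sign τ = a' := by
    rcases hu a a' with rfl | rfl
    · exact ⟨1, by simp, by simp⟩
    · refine ⟨Equiv.swap ⟨0, by omega⟩ ⟨1, by omega⟩,
        fun i hi => Equiv.swap_apply_of_ne_of_ne (hne i hi).1 (hne i hi).2, ?_⟩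
      rw [Equiv.Perm.sign_swap h01, mul_neg_one]
  obtain ⟨s, hs, hss⟩ : ∃ s : Finset (Fin (m + 1)), (∀ i : Fin (m + 1), 2 ≤ (i : ℕ) → i ∉ s) ∧
      b * signProd (markOn s) = b' := by
    rcases hu b b' with rfl | rfl
    · exact ⟨∅, by simp, by simp [signProd_markOn]⟩
    · exact ⟨{⟨0, by omega⟩}, fun i hi => Finset.notMem_singleton.2 (hne i hi).1,
        by simp [signProd_markOn]⟩
  have h := sum_signedAct
    (fun π : BG (m + 1) => if (wordDes (bval π) : ℝ) ≤ y + 2 then 1 else 0) τ (markOn s) a b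
  rw [hτs, hss, ← Finset.card_filter, ← Finset.card_filter] at h
  rw [classWordCount, classWordCount, ← h]
  refine Finset.card_le_card fun π hπ => ?_
  rw [Finset.mem_filter] at hπ ⊢
  refine ⟨hπ.1, ?_⟩
  have : wordDes (bval (signedAct τ (markOn s) π)) ≤ wordDes (bval π) + 2 := by
    refine wordDes_le_add_two fun i hi => ?_
    simp [bval_signedAct, markOn, hs i hi, hτ i hi]
  have : (wordDes (bval (signedAct τ (markOn s) π)) : ℝ) ≤ wordDes (bval π) + 2 := by
    exact_mod_cast this
  linarith [hπ.2]

lemma card_wordDes_bval (m : ℕ) (y : ℝ) :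
    (Finset.univ.filter (fun π : BG (m + 1) => (wordDes (bval π) : ℝ) ≤ y)).card =
      2 ^ (m + 1) * permDesCount m y := by
  let e : BG (m + 1) ≃ (Fin (m + 1) → Bool) × Equiv.Perm (Fin (m + 1)) :=
    { toFun := fun π => (fun j => π.2 (π.1⁻¹ j), π.1)
      invFun := fun x => (x.2, fun i => x.1 (x.2 i))
      left_inv := fun π => by simp
      right_inv := fun x => by simp }
  rw [Finset.card_filter, ← Equiv.sum_comp e.symm, Fintype.sum_prod_type]
  have : ∀ ε : Fin (m + 1) → Bool, ∑ σ : Equiv.Perm (Fin (m + 1)),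
      (if (wordDes (bval (e.symm (ε, σ))) : ℝ) ≤ y then 1 else 0) = permDesCount m y := by
    intro ε
    have hinj : Function.Injective (bval ((1, ε) : BG (m + 1))) := fun i j hij => by
      by_contra hne
      exact bval_ne _ hne hij
    rw [← card_wordDes_comp_perm hinj, Finset.card_filter]
    rfl
  simp only [this]
  simp

lemma sum_classWordCount (m : ℕ) (y : ℝ) :
    ∑ a : ℤˣ, ∑ b : ℤˣ, classWordCount m a b y = 2 ^ (m + 1) * permDesCount m y := by
  rw [← card_wordDes_bval, Finset.card_filter, sum_univ_eq_sum_sgnClass]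
  simp only [classWordCount, Finset.card_filter]

lemma four_mul_classWordCount_le {m : ℕ} (hm : 1 ≤ m) (a b : ℤˣ) (y : ℝ) :
    4 * classWordCount m a b y ≤ 2 ^ (m + 1) * permDesCount m (y + 2) := by
  rw [← sum_classWordCount]
  have := Finset.card_nsmul_le_sum (Finset.univ : Finset (ℤˣ × ℤˣ))
    (fun c => classWordCount m c.1 c.2 (y + 2)) (classWordCount m a b y)
    (fun c _ => classWordCount_le hm a b c.1 c.2 y)
  simpa [Fintype.sum_prod_type] using this

lemma le_four_mul_classWordCount {m : ℕ} (hm : 1 ≤ m) (a b : ℤˣ) (y : ℝ) :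
    2 ^ (m + 1) * permDesCount m y ≤ 4 * classWordCount m a b (y + 2) := by
  rw [← sum_classWordCount]
  have := Finset.sum_le_card_nsmul (Finset.univ : Finset (ℤˣ × ℤˣ))
    (fun c => classWordCount m c.1 c.2 y) (classWordCount m a b (y + 2))
    (fun c _ => classWordCount_le hm c.1 c.2 a b y)
  simpa [Fintype.sum_prod_type] using this

lemma rowCDF_eq {c : ℕ → ℕ → ℕ} {n : ℕ} {a b : ℤˣ}
    (hc : ∀ k, c n k = ((sgnClass n a b).filter (fun π => desD π = k)).card) (y : ℝ) :
    rowCDF c n y = (((sgnClass n a b).filter (fun π => (desD π : ℝ) ≤ y)).card : ℝ) /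
      (sgnClass n a b).card := by
  have := tsum_mul_card_filter_eq (sgnClass n a b) desD (fun k => if (k : ℝ) ≤ y then 1 else 0)
  rw [rowCDF, rowSum_eq hc, Finset.card_filter]
  push_cast
  rw [← this]
  simp [hc]

section rowCDF

variable {c : ℕ → ℕ → ℕ} {n m : ℕ} {a b : ℤˣ}

lemma rowCDF_nonneg (hc : ∀ k, c n k = ((sgnClass n a b).filter (fun π => desD π = k)).card)
    (y : ℝ) : 0 ≤ rowCDF c n y := by
  rw [rowCDF_eq hc]
  positivity

lemma rowCDF_le_one (hc : ∀ k, c n k = ((sgnClass n a b).filter (fun π => desD π = k)).card)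
    (y : ℝ) : rowCDF c n y ≤ 1 := by
  rw [rowCDF_eq hc]
  exact div_le_one_of_le₀ (by exact_mod_cast Finset.card_filter_le _ _) (by positivity)

lemma rowCDF_mono (hc : ∀ k, c n k = ((sgnClass n a b).filter (fun π => desD π = k)).card) :
    Monotone (rowCDF c n) := by
  intro x y hxy
  rw [rowCDF_eq hc, rowCDF_eq hc]
  gcongr

lemma card_sgnClass_eq_div (hm : 1 ≤ m) :
    ((sgnClass (m + 1) a b).card : ℝ) = 2 ^ (m + 1) * (m + 1).factorial / 4 := by
  rw [eq_div_iff (by norm_num), mul_comm]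
  exact_mod_cast four_mul_card_sgnClass (by omega) a b

lemma rowCDF_le_uniformSumCDF (hm : 1 ≤ m)
    (hc : ∀ k, c (m + 1) k = ((sgnClass (m + 1) a b).filter (fun π => desD π = k)).card) (y : ℝ) :
    rowCDF c (m + 1) y ≤ uniformSumCDF (m + 1) (y + 3) := by
  have h1 : ((sgnClass (m + 1) a b).filter (fun π => (desD π : ℝ) ≤ y)).card ≤
      classWordCount m a b y := by
    refine Finset.card_le_card (Finset.monotone_filter_right _ fun π _ h => ?_)
    have : wordDes (bval π) ≤ desD π := by rw [desD_eq_wordDes_add]; omega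
    exact le_trans (by exact_mod_cast this) h
  have h2 : (4 : ℝ) * ((sgnClass (m + 1) a b).filter (fun π => (desD π : ℝ) ≤ y)).card ≤
      2 ^ (m + 1) * permDesCount m (y + 2) := by
    exact_mod_cast (Nat.mul_le_mul_left 4 h1).trans (four_mul_classWordCount_le hm a b y)
  rw [rowCDF_eq hc, card_sgnClass_eq_div hm, show y + 3 = y + 2 + 1 by ring]
  refine le_trans ?_ (permDes_le_uniformSumCDF m (y + 2))
  rw [div_le_div_iff₀ (by positivity) (by positivity)]
  have := mul_le_mul_of_nonneg_right h2 (by positivity : (0 : ℝ) ≤ ((m + 1).factorial : ℝ))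
  linarith

lemma uniformSumCDF_le_rowCDF (hm : 1 ≤ m)
    (hc : ∀ k, c (m + 1) k = ((sgnClass (m + 1) a b).filter (fun π => desD π = k)).card) (y : ℝ) :
    uniformSumCDF (m + 1) (y - 3) ≤ rowCDF c (m + 1) y := by
  have h1 : classWordCount m a b (y - 3 + 2) ≤
      ((sgnClass (m + 1) a b).filter (fun π => (desD π : ℝ) ≤ y)).card := by
    refine Finset.card_le_card (Finset.monotone_filter_right _ fun π _ h => ?_)
    have : desD π ≤ wordDes (bval π) + 1 := by rw [desD_eq_wordDes_add]; split_ifs <;> omega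
    have : (desD π : ℝ) ≤ wordDes (bval π) + 1 := by exact_mod_cast this
    show (desD π : ℝ) ≤ y
    linarith
  have h2 : (2 : ℝ) ^ (m + 1) * permDesCount m (y - 3) ≤
      4 * ((sgnClass (m + 1) a b).filter (fun π => (desD π : ℝ) ≤ y)).card := by
    exact_mod_cast (le_four_mul_classWordCount hm a b (y - 3)).trans (Nat.mul_le_mul_left 4 h1)
  rw [rowCDF_eq hc, card_sgnClass_eq_div hm]
  refine (uniformSumCDF_le_permDes m (y - 3)).trans ?_
  rw [div_le_div_iff₀ (by positivity) (by positivity)]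
  have := mul_le_mul_of_nonneg_right h2 (by positivity : (0 : ℝ) ≤ ((m + 1).factorial : ℝ))
  linarith

end rowCDF

lemma tendsto_normalized_shift (x d : ℝ) :
    Tendsto (fun n : ℕ => (√n)⁻¹ * (√12 * (x * √((n + 2) / 12) + n / 2 + d - n / 2))) atTop
      (𝓝 x) := by
  have h1 : Tendsto (fun n : ℕ => √((n : ℝ) + 2) / √n) atTop (𝓝 1) := by
    have : Tendsto (fun n : ℕ => √(1 + 2 / (n : ℝ))) atTop (𝓝 √(1 + 0)) :=
      (Real.continuous_sqrt.tendsto _).comp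
        (tendsto_const_nhds.add (tendsto_const_div_atTop_nhds_zero_nat 2))
    simp only [add_zero, Real.sqrt_one] at this
    refine this.congr' ?_
    filter_upwards [eventually_gt_atTop 0] with n hn
    have hn' : (0 : ℝ) < n := by exact_mod_cast hn
    rw [← Real.sqrt_div' _ hn'.le]
    congr 1
    field_simp
  have h2 : Tendsto (fun n : ℕ => (√(n : ℝ))⁻¹) atTop (𝓝 0) :=
    tendsto_inv_atTop_zero.comp (Real.tendsto_sqrt_atTop.comp tendsto_natCast_atTop_atTop)
  have h3 := (h1.const_mul x).add (h2.const_mul (√12 * d))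
  rw [mul_one, mul_zero, add_zero] at h3
  refine h3.congr fun n => ?_
  rw [Real.sqrt_div' _ (by norm_num : (0 : ℝ) ≤ 12)]
  have : √(12 : ℝ) ≠ 0 := by positivity
  field_simp
  ring

lemma isAsympNormal_of_sgnClass {c : ℕ → ℕ → ℕ} {a b : ℤˣ}
    (hc : ∀ n k, c n k = ((sgnClass n a b).filter (fun π => desD π = k)).card) :
    IsAsympNormal c := by
  refine tendsto_iSup_abs_sub_of_monotone_s5 (fun n x y hxy => rowCDF_mono (hc n) (by gcongr))
    (fun n x => rowCDF_nonneg (hc n) _) (fun n x => rowCDF_le_one (hc n) _) monotone_stdNormalCDF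
    continuous_stdNormalCDF tendsto_stdNormalCDF_atBot tendsto_stdNormalCDF_atTop fun x => ?_
  refine tendsto_of_tendsto_of_tendsto_of_le_of_le'
    (tendsto_uniformSumCDF (tendsto_normalized_shift x (-3)))
    (tendsto_uniformSumCDF (tendsto_normalized_shift x 3)) ?_ ?_
  · filter_upwards [eventually_ge_atTop 4] with n hn
    obtain ⟨m, rfl⟩ : ∃ m, n = m + 1 := ⟨n - 1, by omega⟩
    rw [rowVar_eq (hc _) hn, rowMean_eq (hc _) (by omega), ← sub_eq_add_neg]
    exact uniformSumCDF_le_rowCDF (by omega) (hc _) _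
  · filter_upwards [eventually_ge_atTop 4] with n hn
    obtain ⟨m, rfl⟩ : ∃ m, n = m + 1 := ⟨n - 1, by omega⟩
    rw [rowVar_eq (hc _) hn, rowMean_eq (hc _) (by omega)]
    exact rowCDF_le_uniformSumCDF (by omega) (hc _) _

end

/-- Theorem: the coefficients of `D_n^±(t)` are asymptotically normal; for `n ≥ 3` the mean
is `n/2` and for `n ≥ 4` the variance is `(n+2)/12`. -/
theorem typeD_clt_des_plus_minus :
    IsAsympNormal cDDesP ∧ IsAsympNormal cDDesM ∧
    (∀ n : ℕ, 3 ≤ n → rowMean cDDesP n = (n : ℝ) / 2 ∧ rowMean cDDesM n = (n : ℝ) / 2) ∧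
    (∀ n : ℕ, 4 ≤ n →
      rowVar cDDesP n = ((n : ℝ) + 2) / 12 ∧ rowVar cDDesM n = ((n : ℝ) + 2) / 12) :=
  ⟨isAsympNormal_of_sgnClass cDDesP_eq, isAsympNormal_of_sgnClass cDDesM_eq,
    fun n hn => ⟨rowMean_eq (cDDesP_eq n) (by omega), rowMean_eq (cDDesM_eq n) (by omega)⟩,
    fun n hn => ⟨rowVar_eq (cDDesP_eq n) hn, rowVar_eq (cDDesM_eq n) hn⟩⟩
end
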